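/- arXiv:math/0503518 — 4 statements merged into one kernel-verified Lean document; each statement's English description precedes it below -/
import Mathlib

section
/- Fix (i₀, j₀) ∈ E with μ_{i₀ j₀} ≥ θ_{i₀}. There exists a constant m₇ > 0, depending only on I, J, E, μ, θ, i₀ and j₀, such that the following holds. Suppose continuous functions x_i, w_i : [0,∞) → ℝ (i ∈ I) and ψ_ij : [0,∞) → ℝ (with ψ_ij ≡ 0 for (i,j) ∉ E) satisfy, for all t ≥ 0, the system x_i(t) = w_i(t) − ∑_{j∈J} μ_ij (𝔍ψ_ij)(t) − θ_i (𝔍y_i)(t), ∑_{j∈J} ψ_ij(t) = x_i(t) − y_i(t), and ∑_{i∈I} ψ_ij(t) = −z_j(t), where y_{i₀}(t) = max(∑_{i∈I} x_i(t), 0), y_i(t) = 0 for i ≠ i₀, z_{j₀}(t) = max(−∑_{i∈I} x_i(t), 0), and z_j(t) = 0 for j ≠ j₀. Then for all t ≥ 0: ∑_{i∈I} |x_i(t)| ≤ m₇ (1+t)^{m₇} · sup_{0≤s≤t} ∑_{i∈I} |w_i(s)|. -/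
open MeasureTheory Set

/-- `(𝔍 f) t = ∫₀ᵗ f(s) ds`. -/
noncomputable def 𝔍 (f : ℝ → ℝ) (t : ℝ) : ℝ := ∫ s in (0:ℝ)..t, f s

/-- The bipartite graph on `I ⊕ J` with an edge between `i : I` and `j : J`
iff `(i, j) ∈ E`. -/
def actGraph {I J : Type*} (E : Set (I × J)) : SimpleGraph (I ⊕ J) :=
  SimpleGraph.fromRel (fun a b => ∃ i j, a = Sum.inl i ∧ b = Sum.inr j ∧ (i, j) ∈ E)

theorem 𝔍_congr {f g : ℝ → ℝ} (h : ∀ t, 0 ≤ t → f t = g t) {t : ℝ} (ht : 0 ≤ t) :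
    𝔍 f t = 𝔍 g t := by
  refine intervalIntegral.integral_congr fun s hs => h s ?_
  rw [uIcc_of_le ht] at hs
  exact hs.1

/-- If `X = W - 𝔍 g`, where `g ≥ 0` whenever `X > 0`, then `X` is bounded above by twice a bound
for `|W|`. -/
theorem le_two_mul_of_eq_sub_𝔍 {X W g : ℝ → ℝ} (hX : Continuous X) (hg : Continuous g)
    (h : ∀ t, 0 ≤ t → X t = W t - 𝔍 g t) (hsign : ∀ t, 0 < X t → 0 ≤ g t)
    {t M : ℝ} (ht : 0 ≤ t) (hM : ∀ s ∈ Icc 0 t, |W s| ≤ M) : X t ≤ 2 * M := by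
  have hM0 : 0 ≤ M := (abs_nonneg _).trans (hM t ⟨ht, le_rfl⟩)
  have hWt := abs_le.1 (hM t ⟨ht, le_rfl⟩)
  by_cases hne : (Icc 0 t ∩ X ⁻¹' Iic 0).Nonempty
  · have hcpt : IsCompact (Icc 0 t ∩ X ⁻¹' Iic 0) :=
      isCompact_Icc.inter_right (isClosed_Iic.preimage hX)
    obtain ⟨s, ⟨hs, hXs⟩, hmax⟩ := hcpt.exists_isGreatest hne
    have hint : 0 ≤ ∫ r in s..t, g r := by
      rw [intervalIntegral.integral_of_le hs.2]
      refine setIntegral_nonneg measurableSet_Ioc fun r hr => hsign r ?_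
      by_contra hXr
      exact absurd (hmax ⟨⟨hs.1.trans hr.1.le, hr.2⟩, not_lt.1 hXr⟩) (not_le.2 hr.1)
    have hsplit : 𝔍 g s + ∫ r in s..t, g r = 𝔍 g t :=
      intervalIntegral.integral_add_adjacent_intervals (hg.intervalIntegrable _ _)
        (hg.intervalIntegrable _ _)
    have hWs := abs_le.1 (hM s hs)
    have hXs' : X s ≤ 0 := hXs
    linarith [h t ht, h s hs.1]
  · have hint : 0 ≤ 𝔍 g t := by
      refine intervalIntegral.integral_nonneg ht fun r hr => hsign r ?_
      by_contra hXr
      exact hne ⟨r, hr, not_lt.1 hXr⟩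
    linarith [h t ht]

/-- If `X = W - 𝔍 g`, where `g` has the sign of `X`, then `|X|` is bounded by twice a bound
for `|W|`. -/
theorem abs_le_two_mul_of_eq_sub_𝔍 {X W g : ℝ → ℝ} (hX : Continuous X) (hg : Continuous g)
    (h : ∀ t, 0 ≤ t → X t = W t - 𝔍 g t) (hpos : ∀ t, 0 < X t → 0 ≤ g t)
    (hneg : ∀ t, X t < 0 → g t ≤ 0)
    {t M : ℝ} (ht : 0 ≤ t) (hM : ∀ s ∈ Icc 0 t, |W s| ≤ M) : |X t| ≤ 2 * M := by
  refine abs_le'.2 ⟨le_two_mul_of_eq_sub_𝔍 hX hg h hpos ht hM, ?_⟩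
  refine le_two_mul_of_eq_sub_𝔍 (X := fun s => -X s) (W := fun s => -W s) (g := fun s => -g s)
    hX.neg hg.neg (fun s hs => ?_) (fun s hs => ?_) ht fun s hs => by rw [abs_neg]; exact hM s hs
  · simp only [𝔍, intervalIntegral.integral_neg]
    have := h s hs
    simp only [𝔍] at this
    linarith
  · linarith [hneg s (by linarith)]

/-- A family of functions `F ω` is bounded on `[0, ∞)` by a polynomial in `t`, uniform in `ω`,
times `S ω t`. -/
def PolyBounded {Ω : Type*} (S F : Ω → ℝ → ℝ) : Prop :=
  ∃ C : ℕ, ∀ ω t, 0 ≤ t → |F ω t| ≤ C * (1 + t) ^ C * S ω t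

namespace PolyBounded

variable {Ω : Type*} {S F G : Ω → ℝ → ℝ}

theorem congr (hF : PolyBounded S F) (h : ∀ ω t, 0 ≤ t → G ω t = F ω t) : PolyBounded S G := by
  obtain ⟨C, hC⟩ := hF
  exact ⟨C, fun ω t ht => by rw [h ω t ht]; exact hC ω t ht⟩

theorem mono_bound {C D : ℕ} (hCD : C ≤ D) {t s : ℝ} (ht : 0 ≤ t) (hs : 0 ≤ s) :
    (C : ℝ) * (1 + t) ^ C * s ≤ D * (1 + t) ^ D * s := by
  have : (1 : ℝ) ≤ 1 + t := by linarith
  gcongr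

theorem zero : PolyBounded S (fun _ _ => 0) :=
  ⟨0, fun ω t _ => by simp⟩

theorem add (hS : ∀ ω t, 0 ≤ t → 0 ≤ S ω t) (hF : PolyBounded S F) (hG : PolyBounded S G) :
    PolyBounded S (fun ω t => F ω t + G ω t) := by
  obtain ⟨C, hC⟩ := hF
  obtain ⟨D, hD⟩ := hG
  refine ⟨C + D, fun ω t ht => (abs_add_le _ _).trans ?_⟩
  have h1 : (1 : ℝ) ≤ 1 + t := by linarith
  have hSt := hS ω t ht
  calc |F ω t| + |G ω t| ≤ C * (1 + t) ^ C * S ω t + D * (1 + t) ^ D * S ω t :=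
        add_le_add (hC ω t ht) (hD ω t ht)
    _ ≤ C * (1 + t) ^ (C + D) * S ω t + D * (1 + t) ^ (C + D) * S ω t := by
        gcongr <;> first | exact h1 | omega
    _ = _ := by push_cast; ring

theorem const_mul (hS : ∀ ω t, 0 ≤ t → 0 ≤ S ω t) (a : ℝ) (hF : PolyBounded S F) :
    PolyBounded S (fun ω t => a * F ω t) := by
  obtain ⟨C, hC⟩ := hF
  obtain ⟨n, hn⟩ := exists_nat_ge |a|
  refine ⟨n * C + C, fun ω t ht => ?_⟩
  have h1 : (1 : ℝ) ≤ 1 + t := by linarith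
  have hSt := hS ω t ht
  rw [abs_mul]
  calc |a| * |F ω t| ≤ n * (C * (1 + t) ^ C * S ω t) :=
        mul_le_mul hn (hC ω t ht) (abs_nonneg _) (by positivity)
    _ = ((n * C : ℕ) : ℝ) * (1 + t) ^ C * S ω t := by push_cast; ring
    _ ≤ _ := by
        gcongr <;> first | exact h1 | omega

theorem neg (hF : PolyBounded S F) : PolyBounded S (fun ω t => -F ω t) := by
  obtain ⟨C, hC⟩ := hF
  exact ⟨C, fun ω t ht => by rw [abs_neg]; exact hC ω t ht⟩

theorem sub (hS : ∀ ω t, 0 ≤ t → 0 ≤ S ω t) (hF : PolyBounded S F) (hG : PolyBounded S G) :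
    PolyBounded S (fun ω t => F ω t - G ω t) :=
  (hF.add hS hG.neg).congr fun _ _ _ => sub_eq_add_neg _ _

theorem abs (hF : PolyBounded S F) : PolyBounded S (fun ω t => |F ω t|) := by
  obtain ⟨C, hC⟩ := hF
  exact ⟨C, fun ω t ht => by rw [abs_abs]; exact hC ω t ht⟩

theorem sum (hS : ∀ ω t, 0 ≤ t → 0 ≤ S ω t) {ι : Type*} (s : Finset ι) {F : ι → Ω → ℝ → ℝ}
    (hF : ∀ i ∈ s, PolyBounded S (F i)) : PolyBounded S (fun ω t => ∑ i ∈ s, F i ω t) := by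
  classical
  induction s using Finset.induction_on with
  | empty => exact zero.congr fun _ _ _ => Finset.sum_empty
  | insert a s ha ih =>
    exact ((hF a (Finset.mem_insert_self _ _)).add hS
      (ih fun i hi => hF i (Finset.mem_insert_of_mem hi))).congr
        fun _ _ _ => Finset.sum_insert ha

theorem integral (hS : ∀ ω t, 0 ≤ t → 0 ≤ S ω t) (hSm : ∀ ω, MonotoneOn (S ω) (Ici 0))
    (hF : PolyBounded S F) : PolyBounded S (fun ω t => 𝔍 (F ω) t) := by
  obtain ⟨C, hC⟩ := hF
  refine ⟨C + 1, fun ω t ht => ?_⟩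
  have h1 : (1 : ℝ) ≤ 1 + t := by linarith
  have hSt := hS ω t ht
  have hbd : ∀ s ∈ uIoc 0 t, ‖F ω s‖ ≤ C * (1 + t) ^ C * S ω t := fun s hs => by
    rw [uIoc_of_le ht] at hs
    have h0 : (0 : ℝ) ≤ 1 + s := by linarith [hs.1]
    refine (hC ω s hs.1.le).trans ?_
    gcongr
    · exact hS ω s hs.1.le
    · exact hs.2
    · exact hSm ω hs.1.le ht hs.2
  calc |𝔍 (F ω) t| ≤ C * (1 + t) ^ C * S ω t * |t - 0| :=
        intervalIntegral.norm_integral_le_of_norm_le_const hbd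
    _ = C * (1 + t) ^ C * S ω t * t := by rw [sub_zero, abs_of_nonneg ht]
    _ ≤ (C + 1) * (1 + t) ^ C * S ω t * (1 + t) := by gcongr <;> linarith
    _ = _ := by push_cast; ring

theorem of_eq_sub_𝔍 (hS : ∀ ω t, 0 ≤ t → 0 ≤ S ω t) (hSm : ∀ ω, MonotoneOn (S ω) (Ici 0))
    {X W g : Ω → ℝ → ℝ} (hX : ∀ ω, Continuous (X ω)) (hg : ∀ ω, Continuous (g ω))
    (h : ∀ ω t, 0 ≤ t → X ω t = W ω t - 𝔍 (g ω) t)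
    (hpos : ∀ ω t, 0 < X ω t → 0 ≤ g ω t) (hneg : ∀ ω t, X ω t < 0 → g ω t ≤ 0)
    (hW : PolyBounded S W) : PolyBounded S X := by
  obtain ⟨C, hC⟩ := hW
  refine ⟨2 * C, fun ω t ht => ?_⟩
  have h1 : (1 : ℝ) ≤ 1 + t := by linarith
  have hSt := hS ω t ht
  have key := abs_le_two_mul_of_eq_sub_𝔍 (hX ω) (hg ω) (h ω) (hpos ω) (hneg ω) ht
    (M := C * (1 + t) ^ C * S ω t) fun s hs => by
      have h0 : (0 : ℝ) ≤ 1 + s := by linarith [hs.1]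
      refine (hC ω s hs.1).trans ?_
      gcongr
      · exact hS ω s hs.1
      · exact hs.2
      · exact hSm ω hs.1 ht hs.2
  refine key.trans ?_
  calc 2 * (C * (1 + t) ^ C * S ω t) = ((2 * C : ℕ) : ℝ) * (1 + t) ^ C * S ω t := by
        push_cast; ring
    _ ≤ _ := by
        gcongr
        first | exact h1 | omega

end PolyBounded

theorem SimpleGraph.Connected.exists_adj_dist_eq_add_one {V : Type*} {G : SimpleGraph V}
    (hG : G.Connected) {u v : V} (hne : v ≠ u) :
    ∃ w, G.Adj w v ∧ G.dist u v = G.dist u w + 1 := by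
  obtain ⟨p, hp⟩ := hG.exists_walk_length_eq_dist u v
  have hnil : ¬ p.Nil := fun h => hne h.eq.symm
  have hadj := p.adj_penultimate hnil
  refine ⟨p.penultimate, hadj, ?_⟩
  have h1 := SimpleGraph.dist_le p.dropLast
  have h2 : p.dropLast.length + 1 = p.length := p.length_dropLast_add_one hnil
  have h3 := hadj.diff_dist_adj (u := u)
  omega

theorem SimpleGraph.IsTree.eq_of_adj_of_dist_eq_add_one {V : Type*} {G : SimpleGraph V}
    (hG : G.IsTree) {u v a b : V} (ha : G.Adj a v) (hb : G.Adj b v)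
    (hda : G.dist u v = G.dist u a + 1) (hdb : G.dist u v = G.dist u b + 1) : a = b := by
  have key : ∀ c, (hc : G.Adj c v) → G.dist u v = G.dist u c + 1 →
      ∃ p : G.Walk u v, p.IsPath ∧ p.penultimate = c := fun c hc hdc => by
    obtain ⟨p, hp⟩ := hG.connected.exists_walk_length_eq_dist u c
    refine ⟨p.concat hc, SimpleGraph.Walk.isPath_of_length_eq_dist _ ?_, by simp⟩
    rw [SimpleGraph.Walk.length_concat, hp, hdc]
  obtain ⟨p, hp, rfl⟩ := key a ha hda
  obtain ⟨q, hq, rfl⟩ := key b hb hdb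
  rw [(hG.existsUnique_path u v).unique hp hq]

theorem actGraph_adj_inl_inr {I J : Type*} {E : Set (I × J)} {i : I} {j : J} :
    (actGraph E).Adj (Sum.inl i) (Sum.inr j) ↔ (i, j) ∈ E := by
  simp [actGraph, SimpleGraph.fromRel_adj]

theorem not_actGraph_adj_inl_inl {I J : Type*} {E : Set (I × J)} {i i' : I} :
    ¬ (actGraph E).Adj (Sum.inl i) (Sum.inl i') := by
  simp [actGraph, SimpleGraph.fromRel_adj]

/-- A solution of the controlled system, with all the queue at `i₀` and all the idleness
at `j₀`. -/
structure FixedControlSystem {I J : Type*} [Fintype I] [Fintype J]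
    (E : Set (I × J)) (μ : I × J → ℝ) (θ : I → ℝ) (i₀ : I) (j₀ : J) where
  x : I → ℝ → ℝ
  w : I → ℝ → ℝ
  y : I → ℝ → ℝ
  z : J → ℝ → ℝ
  ψ : I → J → ℝ → ℝ
  continuous_x : ∀ i, Continuous (x i)
  continuous_w : ∀ i, Continuous (w i)
  continuous_ψ : ∀ i j, Continuous (ψ i j)
  ψ_eq_zero : ∀ i j, (i, j) ∉ E → ψ i j = 0
  y_self : ∀ t : ℝ, y i₀ t = max (∑ i, x i t) 0
  y_of_ne : ∀ i, i ≠ i₀ → ∀ t : ℝ, y i t = 0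
  z_self : ∀ t : ℝ, z j₀ t = max (-∑ i, x i t) 0
  z_of_ne : ∀ j, j ≠ j₀ → ∀ t : ℝ, z j t = 0
  x_eq : ∀ i, ∀ t : ℝ, 0 ≤ t →
    x i t = w i t - ∑ j, μ (i, j) * 𝔍 (ψ i j) t - θ i * 𝔍 (y i) t
  sum_ψ_row : ∀ i, ∀ t : ℝ, 0 ≤ t → ∑ j, ψ i j t = x i t - y i t
  sum_ψ_col : ∀ j, ∀ t : ℝ, 0 ≤ t → ∑ i, ψ i j t = - z j t

namespace FixedControlSystem

variable {I J : Type*} [Fintype I] [Fintype J]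
  {E : Set (I × J)} {μ : I × J → ℝ} {θ : I → ℝ} {i₀ : I} {j₀ : J}

/-- The running supremum of the input `w`. -/
noncomputable def supInput (ω : FixedControlSystem E μ θ i₀ j₀) (t : ℝ) : ℝ :=
  sSup ((fun s => ∑ i, |ω.w i s|) '' Icc 0 t)

theorem bddAbove_input (ω : FixedControlSystem E μ θ i₀ j₀) (t : ℝ) :
    BddAbove ((fun s => ∑ i, |ω.w i s|) '' Icc 0 t) :=
  (isCompact_Icc.image
    (continuous_finsetSum _ fun i _ => (ω.continuous_w i).abs)).bddAbove

theorem supInput_nonneg (ω : FixedControlSystem E μ θ i₀ j₀) (t : ℝ) (_ : 0 ≤ t) :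
    0 ≤ ω.supInput t := by
  refine Real.sSup_nonneg ?_
  rintro _ ⟨s, -, rfl⟩
  exact Finset.sum_nonneg fun i _ => abs_nonneg _

theorem supInput_monotoneOn (ω : FixedControlSystem E μ θ i₀ j₀) :
    MonotoneOn ω.supInput (Ici 0) := fun _ hs t _ hst =>
  csSup_le_csSup (ω.bddAbove_input t) ((nonempty_Icc.2 hs).image _)
    (image_mono (Icc_subset_Icc_right hst))

theorem polyBounded_w (i : I) :
    PolyBounded supInput (fun ω : FixedControlSystem E μ θ i₀ j₀ => ω.w i) := by
  refine ⟨1, fun ω t ht => ?_⟩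
  have h1 : |ω.w i t| ≤ ω.supInput t :=
    (Finset.single_le_sum (f := fun i => |ω.w i t|) (fun i _ => abs_nonneg _)
      (Finset.mem_univ i)).trans
      (le_csSup (ω.bddAbove_input t) ⟨t, ⟨ht, le_rfl⟩, rfl⟩)
  have h2 := ω.supInput_nonneg t ht
  rw [Nat.cast_one, pow_one, one_mul]
  nlinarith

theorem 𝔍_sum_ψ_row (ω : FixedControlSystem E μ θ i₀ j₀) (i : I) (s : Finset J) (t : ℝ) :
    𝔍 (fun r => ∑ j ∈ s, ω.ψ i j r) t = ∑ j ∈ s, 𝔍 (ω.ψ i j) t :=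
  intervalIntegral.integral_finsetSum fun j _ => (ω.continuous_ψ i j).intervalIntegrable _ _

theorem polyBounded_ψ_of_row [DecidableEq J] {i : I} (hi : i ≠ i₀) {j : J}
    (hx : PolyBounded supInput (fun ω : FixedControlSystem E μ θ i₀ j₀ => ω.x i))
    (h : ∀ j', j' ≠ j →
      PolyBounded supInput (fun ω : FixedControlSystem E μ θ i₀ j₀ => ω.ψ i j')) :
    PolyBounded supInput (fun ω : FixedControlSystem E μ θ i₀ j₀ => ω.ψ i j) := by
  refine (hx.sub supInput_nonneg (.sum supInput_nonneg (Finset.univ.erase j)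
    fun j' hj' => h j' (Finset.ne_of_mem_erase hj'))).congr fun ω t ht => ?_
  have h1 := ω.sum_ψ_row i t ht
  rw [ω.y_of_ne i hi, ← Finset.add_sum_erase _ _ (Finset.mem_univ j)] at h1
  linarith

theorem polyBounded_ψ_of_col [DecidableEq I] {j : J} (hj : j ≠ j₀) {i : I}
    (h : ∀ i', i' ≠ i →
      PolyBounded supInput (fun ω : FixedControlSystem E μ θ i₀ j₀ => ω.ψ i' j)) :
    PolyBounded supInput (fun ω : FixedControlSystem E μ θ i₀ j₀ => ω.ψ i j) := by
  refine (PolyBounded.sum supInput_nonneg (Finset.univ.erase i)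
    fun i' hi' => h i' (Finset.ne_of_mem_erase hi')).neg.congr fun ω t ht => ?_
  have h1 := ω.sum_ψ_col j t ht
  rw [ω.z_of_ne j hj, ← Finset.add_sum_erase _ _ (Finset.mem_univ i)] at h1
  linarith

theorem polyBounded_x_of_row [DecidableEq J] {i : I} (hi : i ≠ i₀) {j : J} (hμ : 0 ≤ μ (i, j))
    (h : ∀ j', j' ≠ j →
      PolyBounded supInput (fun ω : FixedControlSystem E μ θ i₀ j₀ => ω.ψ i j')) :
    PolyBounded supInput (fun ω : FixedControlSystem E μ θ i₀ j₀ => ω.x i) := by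
  have hc : PolyBounded supInput (fun (ω : FixedControlSystem E μ θ i₀ j₀) t =>
      ∑ j' ∈ Finset.univ.erase j, ω.ψ i j' t) :=
    .sum supInput_nonneg _ fun j' hj' => h j' (Finset.ne_of_mem_erase hj')
  have hd : PolyBounded supInput (fun (ω : FixedControlSystem E μ θ i₀ j₀) t =>
      ∑ j' ∈ Finset.univ.erase j, μ (i, j') * 𝔍 (ω.ψ i j') t) :=
    .sum supInput_nonneg _ fun j' hj' =>
      ((h j' (Finset.ne_of_mem_erase hj')).integral supInput_nonneg
        supInput_monotoneOn).const_mul supInput_nonneg _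
  refine .of_eq_sub_𝔍 supInput_nonneg supInput_monotoneOn
    (g := fun ω t => μ (i, j) * ω.x i t) (fun ω => ω.continuous_x i)
    (fun ω => (ω.continuous_x i).const_mul _) (fun ω t ht => ?_)
    (fun ω t ht => mul_nonneg hμ ht.le) (fun ω t ht => mul_nonpos_of_nonneg_of_nonpos hμ ht.le)
    (((polyBounded_w i).add supInput_nonneg ((hc.integral supInput_nonneg
      supInput_monotoneOn).const_mul supInput_nonneg (μ (i, j)))).sub supInput_nonneg hd)
  have hJy : 𝔍 (ω.y i) t = 0 := by simp [𝔍, ω.y_of_ne i hi]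
  have hJx : 𝔍 (ω.x i) t =
      𝔍 (ω.ψ i j) t + ∑ j' ∈ Finset.univ.erase j, 𝔍 (ω.ψ i j') t := by
    rw [Finset.add_sum_erase _ (fun j' => 𝔍 (ω.ψ i j') t) (Finset.mem_univ j),
      ← ω.𝔍_sum_ψ_row]
    exact 𝔍_congr (fun s hs => by rw [ω.sum_ψ_row i s hs, ω.y_of_ne i hi, sub_zero]) ht
  have hJμx : 𝔍 (fun s => μ (i, j) * ω.x i s) t = μ (i, j) * 𝔍 (ω.x i) t :=
    intervalIntegral.integral_const_mul _ _
  rw [ω.x_eq i t ht, hJy, hJμx, hJx, ω.𝔍_sum_ψ_row,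
    ← Finset.add_sum_erase _ _ (Finset.mem_univ j)]
  ring

theorem continuous_sum_x (ω : FixedControlSystem E μ θ i₀ j₀) :
    Continuous (fun t => ∑ i, ω.x i t) :=
  continuous_finsetSum _ fun i _ => ω.continuous_x i

theorem continuous_y (ω : FixedControlSystem E μ θ i₀ j₀) : Continuous (ω.y i₀) := by
  rw [funext ω.y_self]
  exact ω.continuous_sum_x.max continuous_const

theorem continuous_z (ω : FixedControlSystem E μ θ i₀ j₀) : Continuous (ω.z j₀) := by
  rw [funext ω.z_self]
  exact ω.continuous_sum_x.neg.max continuous_const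

theorem polyBounded_x_root [DecidableEq I] [DecidableEq J]
    (hμ : 0 ≤ μ (i₀, j₀)) (hθ : 0 ≤ θ i₀)
    (hx : ∀ i, i ≠ i₀ →
      PolyBounded supInput (fun ω : FixedControlSystem E μ θ i₀ j₀ => ω.x i))
    (hrow : ∀ j, j ≠ j₀ →
      PolyBounded supInput (fun ω : FixedControlSystem E μ θ i₀ j₀ => ω.ψ i₀ j))
    (hcol : ∀ i, i ≠ i₀ →
      PolyBounded supInput (fun ω : FixedControlSystem E μ θ i₀ j₀ => ω.ψ i j₀)) :
    PolyBounded supInput (fun ω : FixedControlSystem E μ θ i₀ j₀ => ω.x i₀) := by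
  have hr : PolyBounded supInput (fun (ω : FixedControlSystem E μ θ i₀ j₀) t =>
      ∑ i ∈ Finset.univ.erase i₀, ω.x i t) :=
    .sum supInput_nonneg _ fun i hi => hx i (Finset.ne_of_mem_erase hi)
  have hc : PolyBounded supInput (fun (ω : FixedControlSystem E μ θ i₀ j₀) t =>
      ∑ i ∈ Finset.univ.erase i₀, ω.ψ i j₀ t) :=
    .sum supInput_nonneg _ fun i hi => hcol i (Finset.ne_of_mem_erase hi)
  have hd : PolyBounded supInput (fun (ω : FixedControlSystem E μ θ i₀ j₀) t =>
      ∑ j ∈ Finset.univ.erase j₀, μ (i₀, j) * 𝔍 (ω.ψ i₀ j) t) :=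
    .sum supInput_nonneg _ fun j hj =>
      ((hrow j (Finset.ne_of_mem_erase hj)).integral supInput_nonneg
        supInput_monotoneOn).const_mul supInput_nonneg _
  have hsum : PolyBounded supInput (fun (ω : FixedControlSystem E μ θ i₀ j₀) t =>
      ∑ i, ω.x i t) := by
    refine .of_eq_sub_𝔍 supInput_nonneg supInput_monotoneOn
      (g := fun ω t => θ i₀ * ω.y i₀ t - μ (i₀, j₀) * ω.z j₀ t) continuous_sum_x
      (fun ω => (ω.continuous_y.const_mul _).sub (ω.continuous_z.const_mul _))
      (fun ω t ht => ?_) (fun ω t ht => ?_) (fun ω t ht => ?_)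
      ((((polyBounded_w i₀).add supInput_nonneg ((hc.integral supInput_nonneg
        supInput_monotoneOn).const_mul supInput_nonneg (μ (i₀, j₀)))).sub supInput_nonneg
          hd).add supInput_nonneg hr)
    · have hcont : Continuous fun s => ∑ i ∈ Finset.univ.erase i₀, ω.ψ i j₀ s :=
        continuous_finsetSum _ fun i _ => ω.continuous_ψ i j₀
      have hJψ : 𝔍 (ω.ψ i₀ j₀) t =
          -𝔍 (ω.z j₀) t - 𝔍 (fun s => ∑ i ∈ Finset.univ.erase i₀, ω.ψ i j₀ s) t := by
        rw [𝔍_congr (g := fun s => -ω.z j₀ s - ∑ i ∈ Finset.univ.erase i₀, ω.ψ i j₀ s)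
          (fun s hs => ?_) ht]
        · simp only [𝔍]
          rw [intervalIntegral.integral_sub (f := fun s => -ω.z j₀ s)
            (ω.continuous_z.neg.intervalIntegrable _ _)
            (hcont.intervalIntegrable _ _), intervalIntegral.integral_neg]
        · rw [← ω.sum_ψ_col j₀ s hs, ← Finset.add_sum_erase _ _ (Finset.mem_univ i₀)]
          ring
      have hJg : 𝔍 (fun s => θ i₀ * ω.y i₀ s - μ (i₀, j₀) * ω.z j₀ s) t =
          θ i₀ * 𝔍 (ω.y i₀) t - μ (i₀, j₀) * 𝔍 (ω.z j₀) t := by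
        simp only [𝔍]
        rw [intervalIntegral.integral_sub
          ((ω.continuous_y.const_mul _).intervalIntegrable _ _)
          ((ω.continuous_z.const_mul _).intervalIntegrable _ _),
          intervalIntegral.integral_const_mul, intervalIntegral.integral_const_mul]
      rw [← Finset.add_sum_erase _ _ (Finset.mem_univ i₀), ω.x_eq i₀ t ht, hJg,
        ← Finset.add_sum_erase _ _ (Finset.mem_univ j₀), hJψ]
      ring
    · rw [ω.y_self, ω.z_self, max_eq_left ht.le, max_eq_right (by linarith)]
      nlinarith
    · rw [ω.y_self, ω.z_self, max_eq_right ht.le, max_eq_left (by linarith)]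
      nlinarith
  refine (hsum.sub supInput_nonneg hr).congr fun ω t ht => ?_
  rw [← Finset.add_sum_erase _ _ (Finset.mem_univ i₀)]
  ring

/-- Flows along edges of the tree, and contents of the classes, are estimated from the leaves
towards the root `i₀`. -/
theorem polyBounded_of_dist [DecidableEq I] [DecidableEq J]
    (htree : (actGraph E).IsTree) (hμ : ∀ p ∈ E, 0 < μ p)
    (hE₀ : (i₀, j₀) ∈ E) (d : I ⊕ J → ℕ) (hd : d = (actGraph E).dist (Sum.inl i₀))
    {B : ℕ} (hB : ∀ v, d v < B) (n : ℕ) :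
    (∀ i j, (i, j) ∈ E → d (.inl i) = d (.inr j) + 1 → B ≤ d (.inl i) + n →
      PolyBounded supInput (fun ω : FixedControlSystem E μ θ i₀ j₀ => ω.x i) ∧
      PolyBounded supInput (fun ω : FixedControlSystem E μ θ i₀ j₀ => ω.ψ i j)) ∧
    (∀ i j, (i, j) ∈ E → d (.inr j) = d (.inl i) + 1 → j ≠ j₀ → B ≤ d (.inr j) + n →
      PolyBounded supInput (fun ω : FixedControlSystem E μ θ i₀ j₀ => ω.ψ i j)) := by
  have hroot : d (.inl i₀) = 0 := by rw [hd, SimpleGraph.dist_self]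
  have hroot' : d (.inr j₀) = 1 := by
    rw [hd, SimpleGraph.dist_eq_one_iff_adj, actGraph_adj_inl_inr]
    exact hE₀
  have hstep : ∀ {i j}, (i, j) ∈ E →
      d (.inl i) = d (.inr j) + 1 ∨ d (.inr j) = d (.inl i) + 1 := fun h => by
    rw [hd]
    exact htree.dist_eq_dist_add_one_of_adj _ (actGraph_adj_inl_inr.2 h)
  have hzero : ∀ {i j}, (i, j) ∉ E →
      PolyBounded supInput (fun ω : FixedControlSystem E μ θ i₀ j₀ => ω.ψ i j) := fun h =>
    PolyBounded.zero.congr fun ω t _ => by rw [ω.ψ_eq_zero _ _ h]; rfl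
  induction n with
  | zero => exact ⟨fun i j _ _ h => absurd (hB (.inl i)) (by omega),
      fun i j _ _ _ h => absurd (hB (.inr j)) (by omega)⟩
  | succ n ih =>
    constructor
    · intro i j hij hdij hn
      have hi : i ≠ i₀ := by rintro rfl; omega
      have hother : ∀ j', j' ≠ j →
          PolyBounded supInput (fun ω : FixedControlSystem E μ θ i₀ j₀ => ω.ψ i j') := by
        intro j' hj'
        by_cases hE : (i, j') ∈ E
        · rcases hstep hE with h | h
          · refine absurd (Sum.inr_injective (htree.eq_of_adj_of_dist_eq_add_one
              (actGraph_adj_inl_inr.2 hE).symm (actGraph_adj_inl_inr.2 hij).symm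
              (u := Sum.inl i₀) ?_ ?_)) hj' <;> rw [← hd] <;> assumption
          · exact ih.2 i j' hE h (by rintro rfl; omega) (by omega)
        · exact hzero hE
      have hx := polyBounded_x_of_row hi (hμ _ hij).le hother
      exact ⟨hx, polyBounded_ψ_of_row hi hx hother⟩
    · intro i j hij hdij hj hn
      refine polyBounded_ψ_of_col hj fun i' hi' => ?_
      by_cases hE : (i', j) ∈ E
      · rcases hstep hE with h | h
        · exact (ih.1 i' j hE h (by omega)).2
        · refine absurd (Sum.inl_injective (htree.eq_of_adj_of_dist_eq_add_one
            (actGraph_adj_inl_inr.2 hE) (actGraph_adj_inl_inr.2 hij)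
            (u := Sum.inl i₀) ?_ ?_)) hi' <;> rw [← hd] <;> assumption
      · exact hzero hE

theorem polyBounded_x [DecidableEq I] [DecidableEq J]
    (htree : (actGraph E).IsTree) (hμ : ∀ p ∈ E, 0 < μ p)
    (hθ : ∀ i, 0 ≤ θ i) (hE₀ : (i₀, j₀) ∈ E) (i : I) :
    PolyBounded supInput (fun ω : FixedControlSystem E μ θ i₀ j₀ => ω.x i) := by
  obtain ⟨d, hd⟩ : ∃ d, d = (actGraph E).dist (Sum.inl i₀) := ⟨_, rfl⟩
  obtain ⟨B, hB⟩ : ∃ B, ∀ v, d v < B :=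
    ⟨Finset.univ.sup d + 1, fun v => Nat.lt_succ_of_le (Finset.le_sup (Finset.mem_univ v))⟩
  obtain ⟨hup, hdown⟩ := polyBounded_of_dist (θ := θ) htree hμ hE₀ d hd hB B
  have hroot : d (.inl i₀) = 0 := by rw [hd, SimpleGraph.dist_self]
  have hroot' : d (.inr j₀) = 1 := by
    rw [hd, SimpleGraph.dist_eq_one_iff_adj, actGraph_adj_inl_inr]
    exact hE₀
  have hstep : ∀ {i j}, (i, j) ∈ E →
      d (.inl i) = d (.inr j) + 1 ∨ d (.inr j) = d (.inl i) + 1 := fun h => by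
    rw [hd]
    exact htree.dist_eq_dist_add_one_of_adj _ (actGraph_adj_inl_inr.2 h)
  have hzero : ∀ {i j}, (i, j) ∉ E →
      PolyBounded supInput (fun ω : FixedControlSystem E μ θ i₀ j₀ => ω.ψ i j) := fun h =>
    PolyBounded.zero.congr fun ω t _ => by rw [ω.ψ_eq_zero _ _ h]; rfl
  have hx : ∀ i, i ≠ i₀ →
      PolyBounded supInput (fun ω : FixedControlSystem E μ θ i₀ j₀ => ω.x i) := fun i hi => by
    obtain ⟨v, hadj, hv⟩ := htree.connected.exists_adj_dist_eq_add_one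
      (u := Sum.inl i₀) (v := Sum.inl i) (fun h => hi (Sum.inl_injective h))
    rcases v with i' | j
    · exact absurd hadj not_actGraph_adj_inl_inl
    · exact (hup i j (actGraph_adj_inl_inr.1 hadj.symm) (by rw [hd]; exact hv) (by omega)).1
  by_cases hi : i = i₀
  · subst hi
    refine polyBounded_x_root (hμ _ hE₀).le (hθ _) hx (fun j hj => ?_) (fun i' hi' => ?_)
    · by_cases hE : (i, j) ∈ E
      · exact hdown i j hE (by have := hstep hE; omega) hj (by omega)
      · exact hzero hE
    · by_cases hE : (i', j₀) ∈ E
      · rcases hstep hE with h | h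
        · exact (hup i' j₀ hE h (by omega)).2
        · refine absurd (Sum.inl_injective (htree.eq_of_adj_of_dist_eq_add_one
            (actGraph_adj_inl_inr.2 hE) (actGraph_adj_inl_inr.2 hE₀)
            (u := Sum.inl i) ?_ ?_)) hi' <;> rw [← hd] <;> omega
      · exact hzero hE
  · exact hx i hi

end FixedControlSystem

/-- Proposition 3: fix an activity `(i₀, j₀) ∈ E` with
`μ_{i₀j₀} ≥ θ_{i₀}`, and consider the control that puts all the queue at `i₀` and all the
idleness at `j₀`: `y_{i₀} = (∑_i x_i)⁺`, `y_i = 0` for `i ≠ i₀`, `z_{j₀} = (∑_i x_i)⁻`,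
`z_j = 0` for `j ≠ j₀`. Then
`∑_i |x_i(t)| ≤ m₇ (1+t)^{m₇} sup_{0≤s≤t} ∑_i |w_i(s)|`
with `m₇` depending only on the structural data. -/
theorem estimate_fixed_control
    {I J : Type*} [Fintype I] [Fintype J] [Nonempty I] [Nonempty J]
    (E : Set (I × J)) (μ : I × J → ℝ) (θ : I → ℝ)
    (htree : (actGraph E).IsTree)
    (hμpos : ∀ p ∈ E, 0 < μ p) (hμzero : ∀ p : I × J, p ∉ E → μ p = 0)
    (hθ : ∀ i, 0 ≤ θ i)
    (i₀ : I) (j₀ : J) (hE₀ : (i₀, j₀) ∈ E) (hθμ : θ i₀ ≤ μ (i₀, j₀)) :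
    ∃ m₇ : ℝ, 0 < m₇ ∧
      ∀ (x w y : I → ℝ → ℝ) (z : J → ℝ → ℝ) (ψ : I → J → ℝ → ℝ),
        (∀ i, Continuous (x i)) → (∀ i, Continuous (w i)) →
        (∀ i j, Continuous (ψ i j)) →
        (∀ i j, (i, j) ∉ E → ψ i j = 0) →
        (∀ t : ℝ, y i₀ t = max (∑ i, x i t) 0) →
        (∀ i, i ≠ i₀ → ∀ t : ℝ, y i t = 0) →
        (∀ t : ℝ, z j₀ t = max (-∑ i, x i t) 0) →
        (∀ j, j ≠ j₀ → ∀ t : ℝ, z j t = 0) →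
        (∀ i, ∀ t : ℝ, 0 ≤ t →
          x i t = w i t - ∑ j, μ (i, j) * 𝔍 (ψ i j) t - θ i * 𝔍 (y i) t) →
        (∀ i, ∀ t : ℝ, 0 ≤ t → ∑ j, ψ i j t = x i t - y i t) →
        (∀ j, ∀ t : ℝ, 0 ≤ t → ∑ i, ψ i j t = - z j t) →
        ∀ t : ℝ, 0 ≤ t →
          ∑ i, |x i t| ≤
            m₇ * (1 + t) ^ m₇ * sSup ((fun s => ∑ i, |w i s|) '' Icc 0 t) := by
  classical
  obtain ⟨C, hC⟩ := PolyBounded.sum FixedControlSystem.supInput_nonneg Finset.univ fun i _ =>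
    (FixedControlSystem.polyBounded_x (θ := θ) htree hμpos hθ hE₀ i).abs
  refine ⟨(C + 1 : ℕ), by positivity, ?_⟩
  intro x w y z ψ hx hw hψ hψ0 hy hy' hz hz' heq hrow hcol t ht
  let ω : FixedControlSystem E μ θ i₀ j₀ :=
    ⟨x, w, y, z, ψ, hx, hw, hψ, hψ0, hy, hy', hz, hz', heq, hrow, hcol⟩
  rw [Real.rpow_natCast]
  exact (le_abs_self _).trans ((hC ω t ht).trans
    (PolyBounded.mono_bound C.le_succ ht (ω.supInput_nonneg t ht)))
end

section
/- There exists a constant m₅ > 0, depending only on I, J, i₀, j₀, μ and θ, such that for every T > 0, every family of measurable, locally bounded functions (ψ_ij, y_i, z_j, w_i) satisfying (66)–(69) on [0,T], and every family of bounded measurable functions f_i : [0,T] → ℝ with f_i ≥ 0 (i ∈ I), there exists a family of measurable, locally bounded functions (ψ̂_ij, ŷ_i, ẑ_j, ŵ_i) satisfying (66)–(69) on [0,T] and moreover: ∑_{i∈I} ŷ_i(t) ≥ ∑_{i∈I} y_i(t) and ∑_{j∈J} ẑ_j(t) ≤ ∑_{j∈J} z_j(t) for all t ∈ [0,T], and ŵ_i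 = w_i + f_i + η_i for each i ∈ I, where each η_i : [0,T] → ℝ is nondecreasing and continuous with 0 ≤ η_i(t) ≤ m₅ · T · ∑_{i'∈I} sup_{0≤s≤T} |f_{i'}(s)| for all t ∈ [0,T]. -/
open MeasureTheory Set

/-- The system (66)–(69) on the time set `S`, for the diameter-≤3 tree whose activity set
is `E = {(i,j₀) : i ∈ I} ∪ {(i₀,j) : j ∈ J}`. -/
def Sys {I J : Type*} [Fintype I] [Fintype J] (i₀ : I) (j₀ : J)
    (μ : I × J → ℝ) (θ : I → ℝ)
    (ψ : I → J → ℝ → ℝ) (y w : I → ℝ → ℝ) (z : J → ℝ → ℝ) (S : Set ℝ) : Prop :=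
  (∀ i j, ¬(j = j₀ ∨ i = i₀) → ∀ t ∈ S, ψ i j t = 0) ∧
  (∀ i, ∀ t ∈ S, ∑ j, (ψ i j t + μ (i, j) * 𝔍 (ψ i j) t)
      = w i t - y i t - θ i * 𝔍 (y i) t) ∧
  (∀ j, ∀ t ∈ S, ∑ i, ψ i j t = - z j t) ∧
  (∀ i, ∀ t ∈ S, 0 ≤ y i t) ∧
  (∀ j, ∀ t ∈ S, 0 ≤ z j t) ∧
  (∀ t ∈ S, min (∑ i, y i t) (∑ j, z j t) = 0)

section StaticAllocation

lemma min_div_mul_self {a b : ℝ} (ha : 0 ≤ a) (hb : 0 ≤ b) :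
    0 ≤ min a b / a ∧ min a b / a ≤ 1 ∧ a * (min a b / a) = min a b := by
  rcases ha.eq_or_lt with rfl | ha
  · simp [hb]
  · refine ⟨div_nonneg (le_min ha.le hb) ha.le, (div_le_one ha).2 (min_le_left _ _), ?_⟩
    field_simp

variable {I J : Type*} [Fintype I] [Fintype J]
  {i₀ : I} {j₀ : J} {f : I → ℝ} {z : J → ℝ} {h : ℝ}

/-- The fraction of `z` that is cancelled when an amount `D` arrives. -/
noncomputable def cancelShare (z : J → ℝ) (D : ℝ) : ℝ := min (∑ j, z j) D / ∑ j, z j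

/-- The increment of `z` in the static allocation of inputs `f`, plus `h` at `i₀`. -/
noncomputable def incrZ (f : I → ℝ) (z : J → ℝ) (h : ℝ) (j : J) : ℝ :=
  -(z j * cancelShare z (∑ i, f i + h))

lemma sum_nonneg_add (hf : ∀ i, 0 ≤ f i) (hh : 0 ≤ h) : 0 ≤ ∑ i, f i + h :=
  add_nonneg (Finset.sum_nonneg fun i _ => hf i) hh

lemma cancelShare_spec (hf : ∀ i, 0 ≤ f i) (hz : ∀ j, 0 ≤ z j) (hh : 0 ≤ h) :
    0 ≤ cancelShare z (∑ i, f i + h) ∧ cancelShare z (∑ i, f i + h) ≤ 1 ∧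
      (∑ j, z j) * cancelShare z (∑ i, f i + h) = min (∑ j, z j) (∑ i, f i + h) :=
  min_div_mul_self (Finset.sum_nonneg fun j _ => hz j) (sum_nonneg_add hf hh)

lemma sum_incrZ (hf : ∀ i, 0 ≤ f i) (hz : ∀ j, 0 ≤ z j) (hh : 0 ≤ h) :
    ∑ j, incrZ f z h j = -min (∑ j, z j) (∑ i, f i + h) := by
  simp only [incrZ]
  rw [Finset.sum_neg_distrib, ← Finset.sum_mul, (cancelShare_spec hf hz hh).2.2]

lemma incrZ_nonpos (hf : ∀ i, 0 ≤ f i) (hz : ∀ j, 0 ≤ z j) (hh : 0 ≤ h) (j : J) :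
    incrZ f z h j ≤ 0 :=
  neg_nonpos.2 (mul_nonneg (hz j) (cancelShare_spec hf hz hh).1)

lemma neg_le_incrZ (hf : ∀ i, 0 ≤ f i) (hz : ∀ j, 0 ≤ z j) (hh : 0 ≤ h) (j : J) :
    -z j ≤ incrZ f z h j :=
  neg_le_neg (mul_le_of_le_one_right (hz j) (cancelShare_spec hf hz hh).2.1)

lemma mul_cancelShare_le (hf : ∀ i, 0 ≤ f i) (hz : ∀ j, 0 ≤ z j) (hh : 0 ≤ h) (j : J) :
    z j * cancelShare z (∑ i, f i + h) ≤ ∑ i, f i + h := by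
  obtain ⟨h1, -, h2⟩ := cancelShare_spec hf hz hh
  calc _ ≤ (∑ j, z j) * cancelShare z (∑ i, f i + h) :=
        mul_le_mul_of_nonneg_right
          (Finset.single_le_sum (fun j _ => hz j) (Finset.mem_univ j)) h1
    _ ≤ _ := h2 ▸ min_le_right _ _

variable [DecidableEq I]

/-- The total of `f` away from the distinguished index `i₀`. -/
noncomputable def offTotal (i₀ : I) (f : I → ℝ) : ℝ := ∑ i, if i = i₀ then 0 else f i

/-- The fraction of `f`, away from `i₀`, that is added to `y` when an amount `D` arrives. -/
noncomputable def addShare (i₀ : I) (f : I → ℝ) (z : J → ℝ) (D : ℝ) : ℝ :=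
  min (offTotal i₀ f) (D - min (∑ j, z j) D) / offTotal i₀ f

/-- The increment of `y` in the static allocation of inputs `f`, plus `h` at `i₀`. -/
noncomputable def incrY (i₀ : I) (f : I → ℝ) (z : J → ℝ) (h : ℝ) (i : I) : ℝ :=
  if i = i₀ then ∑ i, f i + h - min (∑ j, z j) (∑ i, f i + h)
      - min (offTotal i₀ f) (∑ i, f i + h - min (∑ j, z j) (∑ i, f i + h))
  else f i * addShare i₀ f z (∑ i, f i + h)

lemma sum_eq_add_offTotal (i₀ : I) (f : I → ℝ) : ∑ i, f i = f i₀ + offTotal i₀ f := by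
  have h : ∀ i, f i = (if i = i₀ then f i else 0) + (if i = i₀ then 0 else f i) := by
    intro i; split_ifs <;> simp
  rw [offTotal, Finset.sum_congr rfl fun i _ => h i, Finset.sum_add_distrib]
  simp

lemma offTotal_nonneg (i₀ : I) {f : I → ℝ} (hf : ∀ i, 0 ≤ f i) : 0 ≤ offTotal i₀ f :=
  Finset.sum_nonneg fun i _ => by split_ifs <;> simp [hf i]

lemma offTotal_le_sum (i₀ : I) {f : I → ℝ} (hf : ∀ i, 0 ≤ f i) : offTotal i₀ f ≤ ∑ i, f i := by
  rw [sum_eq_add_offTotal i₀ f]; linarith [hf i₀]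

lemma addShare_spec (hf : ∀ i, 0 ≤ f i) :
    0 ≤ addShare i₀ f z (∑ i, f i + h) ∧ addShare i₀ f z (∑ i, f i + h) ≤ 1 ∧
      offTotal i₀ f * addShare i₀ f z (∑ i, f i + h) =
        min (offTotal i₀ f) (∑ i, f i + h - min (∑ j, z j) (∑ i, f i + h)) :=
  min_div_mul_self (offTotal_nonneg i₀ hf) (sub_nonneg.2 (min_le_right _ _))

lemma offTotal_mul (c : ℝ) : offTotal i₀ (fun i => f i * c) = offTotal i₀ f * c := by
  simp [offTotal, Finset.sum_mul, ite_mul]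

lemma offTotal_congr {g : I → ℝ} (hg : ∀ i, i ≠ i₀ → f i = g i) :
    offTotal i₀ f = offTotal i₀ g :=
  Finset.sum_congr rfl fun i _ => by split_ifs with hi <;> simp [hg i, hi]

lemma offTotal_incrY (hf : ∀ i, 0 ≤ f i) :
    offTotal i₀ (incrY i₀ f z h) =
      min (offTotal i₀ f) (∑ i, f i + h - min (∑ j, z j) (∑ i, f i + h)) := by
  rw [← (addShare_spec hf).2.2, ← offTotal_mul]
  exact offTotal_congr fun i hi => by simp [incrY, hi]

lemma sum_incrY (hf : ∀ i, 0 ≤ f i) :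
    ∑ i, incrY i₀ f z h i = ∑ i, f i + h - min (∑ j, z j) (∑ i, f i + h) := by
  rw [sum_eq_add_offTotal i₀, offTotal_incrY hf]
  simp [incrY]

lemma incrY_nonneg (hf : ∀ i, 0 ≤ f i) (i : I) : 0 ≤ incrY i₀ f z h i := by
  rw [incrY]
  split_ifs
  · exact sub_nonneg.2 (min_le_right _ _)
  · exact mul_nonneg (hf i) (addShare_spec hf).1

lemma incrY_le (hf : ∀ i, 0 ≤ f i) (hz : ∀ j, 0 ≤ z j) (hh : 0 ≤ h) (i : I) :
    incrY i₀ f z h i ≤ ∑ i, f i + h := by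
  refine (Finset.single_le_sum (f := incrY i₀ f z h) (fun i _ => incrY_nonneg hf i)
    (Finset.mem_univ i)).trans ?_
  rw [sum_incrY hf]
  have : 0 ≤ min (∑ j, z j) (∑ i, f i + h) :=
    le_min (Finset.sum_nonneg fun j _ => hz j) (sum_nonneg_add hf hh)
  linarith

variable [DecidableEq J]

/-- The increment of `ψ` in the static allocation of inputs `f`, plus `h` at `i₀`. -/
noncomputable def incrPsi (i₀ : I) (j₀ : J) (f : I → ℝ) (z : J → ℝ) (h : ℝ) (i : I) (j : J) : ℝ :=
  (if i = i₀ then z j * cancelShare z (∑ i, f i + h) else 0) +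
  (if j = j₀ then
    (if i = i₀ then
      -(offTotal i₀ f - min (offTotal i₀ f) (∑ i, f i + h - min (∑ j, z j) (∑ i, f i + h)))
    else f i * (1 - addShare i₀ f z (∑ i, f i + h))) else 0)

lemma incrPsi_eq_zero {i : I} {j : J} (hij : ¬(j = j₀ ∨ i = i₀)) :
    incrPsi i₀ j₀ f z h i j = 0 := by
  push Not at hij
  simp [incrPsi, hij.1, hij.2]

lemma sum_incrPsi_add_incrY (hf : ∀ i, 0 ≤ f i) (hz : ∀ j, 0 ≤ z j) (hh : 0 ≤ h) (i : I) :
    ∑ j, incrPsi i₀ j₀ f z h i j + incrY i₀ f z h i = f i + if i = i₀ then h else 0 := by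
  simp only [incrPsi, Finset.sum_add_distrib, Finset.sum_ite_eq', Finset.mem_univ, if_true]
  by_cases hi : i = i₀
  · subst hi
    simp only [incrY, if_true]
    rw [← Finset.sum_mul, (cancelShare_spec hf hz hh).2.2]
    linarith [sum_eq_add_offTotal i f]
  · simp only [hi, incrY, if_false, Finset.sum_const_zero]
    ring

lemma sum_incrPsi (hf : ∀ i, 0 ≤ f i) (j : J) :
    ∑ i, incrPsi i₀ j₀ f z h i j = -incrZ f z h j := by
  rw [sum_eq_add_offTotal i₀]
  by_cases hj : j = j₀
  · have : offTotal i₀ (fun i => incrPsi i₀ j₀ f z h i j) =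
        offTotal i₀ f * (1 - addShare i₀ f z (∑ i, f i + h)) := by
      rw [← offTotal_mul]
      exact offTotal_congr fun i hi => by simp [incrPsi, hi, hj]
    rw [this, mul_sub, (addShare_spec hf).2.2]
    simp only [incrPsi, hj, incrZ, if_true]
    ring
  · have : offTotal i₀ (fun i => incrPsi i₀ j₀ f z h i j) = 0 := by
      rw [← mul_zero (offTotal i₀ f), ← offTotal_mul]
      exact offTotal_congr fun i hi => by simp [incrPsi, hi, hj]
    rw [this]
    simp [incrPsi, hj, incrZ]

lemma incrPsi_nonneg (hf : ∀ i, 0 ≤ f i) {i : I} (hi : i ≠ i₀) (j : J) :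
    0 ≤ incrPsi i₀ j₀ f z h i j := by
  simp only [incrPsi, hi, if_false, zero_add]
  split_ifs
  · exact mul_nonneg (hf i) (sub_nonneg.2 (addShare_spec hf).2.1)
  · rfl

lemma abs_incrPsi_le (hf : ∀ i, 0 ≤ f i) (hz : ∀ j, 0 ≤ z j) (hh : 0 ≤ h) (i : I) (j : J) :
    |incrPsi i₀ j₀ f z h i j| ≤ ∑ i, f i + h := by
  have hD := sum_nonneg_add hf hh
  have h1 := mul_cancelShare_le hf hz hh j
  have h2 := mul_nonneg (hz j) (cancelShare_spec hf hz hh).1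
  have h3 := offTotal_le_sum i₀ hf
  have h4 := offTotal_nonneg i₀ hf
  by_cases hi : i = i₀
  · have h5 : 0 ≤ min (offTotal i₀ f) (∑ i, f i + h - min (∑ j, z j) (∑ i, f i + h)) :=
      le_min h4 (sub_nonneg.2 (min_le_right _ _))
    have h6 := min_le_left (offTotal i₀ f) (∑ i, f i + h - min (∑ j, z j) (∑ i, f i + h))
    simp only [incrPsi, hi, if_true]
    rw [abs_le]
    split_ifs <;> constructor <;> linarith
  · rw [abs_of_nonneg (incrPsi_nonneg hf hi j)]
    simp only [incrPsi, hi, if_false, zero_add]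
    split_ifs
    · have h5 := addShare_spec (z := z) (i₀ := i₀) (h := h) hf
      have h6 : f i ≤ ∑ i, f i := Finset.single_le_sum (fun i _ => hf i) (Finset.mem_univ i)
      nlinarith [hf i, mul_nonneg (hf i) h5.1]
    · exact hD

lemma weighted_sum_incrPsi_ge (hf : ∀ i, 0 ≤ f i) (hz : ∀ j, 0 ≤ z j) (hh : 0 ≤ h)
    {c : J → ℝ} {m : ℝ} (hm : 0 ≤ m) (hc : ∀ j, m ≤ c j) :
    min 0 (m * h - c j₀ * ∑ i, f i) ≤ ∑ j, c j * incrPsi i₀ j₀ f z h i₀ j := by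
  have hS : m * min (∑ j, z j) (∑ i, f i + h) ≤
      ∑ j, c j * (z j * cancelShare z (∑ i, f i + h)) := by
    rw [← (cancelShare_spec hf hz hh).2.2, Finset.sum_mul, Finset.mul_sum]
    exact Finset.sum_le_sum fun j _ => mul_le_mul_of_nonneg_right (hc j)
      (mul_nonneg (hz j) (cancelShare_spec hf hz hh).1)
  simp only [incrPsi, if_true, mul_add, Finset.sum_add_distrib, mul_ite, mul_zero,
    Finset.sum_ite_eq', Finset.mem_univ]
  have hmin : 0 ≤ min (∑ j, z j) (∑ i, f i + h) :=
    le_min (Finset.sum_nonneg fun j _ => hz j) (sum_nonneg_add hf hh)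
  have hG := offTotal_le_sum i₀ hf
  have hG0 := offTotal_nonneg i₀ hf
  have hc0 : 0 ≤ c j₀ := hm.trans (hc j₀)
  rcases le_total (offTotal i₀ f) (∑ i, f i + h - min (∑ j, z j) (∑ i, f i + h)) with hle | hle
  · refine (min_le_left _ _).trans ?_
    rw [min_eq_left hle]
    nlinarith [mul_nonneg hm hmin]
  · refine (min_le_right _ _).trans ?_
    rw [min_eq_right hle]
    have h1 : m * h ≤ m * min (∑ j, z j) (∑ i, f i + h) :=
      mul_le_mul_of_nonneg_left (by linarith) hm
    have h2 : c j₀ * (offTotal i₀ f - (∑ i, f i + h - min (∑ j, z j) (∑ i, f i + h))) ≤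
        c j₀ * ∑ i, f i :=
      mul_le_mul_of_nonneg_left (by linarith [min_le_right (∑ j, z j) (∑ i, f i + h)]) hc0
    linarith

end StaticAllocation

section StaticMeasurable

variable {I J : Type*} [Fintype I] [Fintype J]
  {i₀ : I} {j₀ : J} {f : I → ℝ → ℝ} {z : J → ℝ → ℝ} {h : ℝ → ℝ}

lemma measurable_cancelShare (hf : ∀ i, Measurable (f i)) (hz : ∀ j, Measurable (z j))
    (hh : Measurable h) :
    Measurable fun t => cancelShare (fun j => z j t) (∑ i, f i t + h t) := by
  unfold cancelShare
  fun_prop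

lemma measurable_incrZ (hf : ∀ i, Measurable (f i)) (hz : ∀ j, Measurable (z j))
    (hh : Measurable h) (j : J) :
    Measurable fun t => incrZ (fun i => f i t) (fun j => z j t) (h t) j := by
  have := measurable_cancelShare hf hz hh
  unfold incrZ
  fun_prop

variable [DecidableEq I]

lemma measurable_offTotal (hf : ∀ i, Measurable (f i)) :
    Measurable fun t => offTotal i₀ fun i => f i t := by
  unfold offTotal
  refine Finset.measurable_fun_sum _ fun i _ => ?_
  split_ifs
  · exact measurable_const
  · exact hf i

lemma measurable_addShare (hf : ∀ i, Measurable (f i)) (hz : ∀ j, Measurable (z j))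
    (hh : Measurable h) :
    Measurable fun t =>
      addShare i₀ (fun i => f i t) (fun j => z j t) (∑ i, f i t + h t) := by
  have := measurable_offTotal (i₀ := i₀) hf
  unfold addShare
  fun_prop

lemma measurable_incrY (hf : ∀ i, Measurable (f i)) (hz : ∀ j, Measurable (z j))
    (hh : Measurable h) (i : I) :
    Measurable fun t => incrY i₀ (fun i => f i t) (fun j => z j t) (h t) i := by
  have := measurable_offTotal (i₀ := i₀) hf
  have := measurable_addShare (i₀ := i₀) hf hz hh
  unfold incrY
  split_ifs <;> fun_prop

variable [DecidableEq J]

lemma measurable_incrPsi (hf : ∀ i, Measurable (f i)) (hz : ∀ j, Measurable (z j))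
    (hh : Measurable h) (i : I) (j : J) :
    Measurable fun t => incrPsi i₀ j₀ (fun i => f i t) (fun j => z j t) (h t) i j := by
  have := measurable_offTotal (i₀ := i₀) hf
  have := measurable_addShare (i₀ := i₀) hf hz hh
  have := measurable_cancelShare hf hz hh
  unfold incrPsi
  split_ifs <;> fun_prop

end StaticMeasurable

section Integral

lemma intervalIntegrable_of_bounded {u : ℝ → ℝ} {T C : ℝ} (hu : Measurable u)
    (hC : ∀ t ∈ Icc (0:ℝ) T, |u t| ≤ C) {a b : ℝ} (ha : a ∈ Icc 0 T) (hb : b ∈ Icc 0 T) :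
    IntervalIntegrable u volume a b := by
  have hsub : uIcc a b ⊆ Icc 0 T := uIcc_subset_Icc ha hb
  refine ⟨?_, ?_⟩ <;>
  · refine Measure.integrableOn_of_bounded (M := C) (by simp) hu.aestronglyMeasurable ?_
    refine (ae_restrict_iff' measurableSet_Ioc).2 (ae_of_all _ fun t ht => ?_)
    exact hC t (hsub (by
      first
      | exact Ioc_subset_Icc_self.trans Icc_subset_uIcc ht
      | exact Ioc_subset_Icc_self.trans Icc_subset_uIcc' ht))

variable {u : ℝ → ℝ} {T C : ℝ}

lemma 𝔍_monotoneOn (hu : Measurable u) (h0 : ∀ t ∈ Icc (0:ℝ) T, 0 ≤ u t)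
    (hC : ∀ t ∈ Icc (0:ℝ) T, u t ≤ C) : MonotoneOn (𝔍 u) (Icc 0 T) := by
  intro a ha b hb hab
  have hC' : ∀ t ∈ Icc (0:ℝ) T, |u t| ≤ C := fun t ht => by
    rw [abs_of_nonneg (h0 t ht)]; exact hC t ht
  have h00 : (0:ℝ) ∈ Icc 0 T := ⟨le_rfl, ha.1.trans ha.2⟩
  rw [𝔍, 𝔍, ← sub_nonneg, intervalIntegral.integral_interval_sub_left
    (intervalIntegrable_of_bounded hu hC' h00 hb) (intervalIntegrable_of_bounded hu hC' h00 ha)]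
  exact intervalIntegral.integral_nonneg hab fun t ht => h0 t ⟨ha.1.trans ht.1, ht.2.trans hb.2⟩

lemma 𝔍_continuousOn (hT : 0 ≤ T) (hu : Measurable u) (hC : ∀ t ∈ Icc (0:ℝ) T, |u t| ≤ C) :
    ContinuousOn (𝔍 u) (Icc 0 T) := by
  have := intervalIntegral.continuousOn_primitive_interval (f := u) (a := 0) (b := T) (μ := volume)
    ((intervalIntegrable_iff' (by simp)).1
      (intervalIntegrable_of_bounded hu hC ⟨le_rfl, hT⟩ ⟨hT, le_rfl⟩))
  rwa [uIcc_of_le hT] at this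

lemma 𝔍_nonneg (h0 : ∀ t ∈ Icc (0:ℝ) T, 0 ≤ u t) {t : ℝ} (ht : t ∈ Icc 0 T) : 0 ≤ 𝔍 u t :=
  intervalIntegral.integral_nonneg ht.1 fun s hs => h0 s ⟨hs.1, hs.2.trans ht.2⟩

lemma 𝔍_le (hu : Measurable u) (h0 : ∀ t ∈ Icc (0:ℝ) T, 0 ≤ u t)
    (hC : ∀ t ∈ Icc (0:ℝ) T, u t ≤ C) {t : ℝ} (ht : t ∈ Icc 0 T) : 𝔍 u t ≤ C * T := by
  have hC' : ∀ t ∈ Icc (0:ℝ) T, |u t| ≤ C := fun t ht => by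
    rw [abs_of_nonneg (h0 t ht)]; exact hC t ht
  have h00 : (0:ℝ) ∈ Icc 0 T := ⟨le_rfl, ht.1.trans ht.2⟩
  calc 𝔍 u t ≤ ∫ _ in (0:ℝ)..t, C :=
        intervalIntegral.integral_mono_on ht.1 (intervalIntegrable_of_bounded hu hC' h00 ht)
          (by simp) fun s hs => hC s ⟨hs.1, hs.2.trans ht.2⟩
    _ = C * t := by simp [mul_comm]
    _ ≤ C * T := mul_le_mul_of_nonneg_left ht.2 ((h0 t ht).trans (hC t ht))

lemma 𝔍_exp {m : ℝ} (hm : 0 < m) (A t : ℝ) :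
    𝔍 (fun s => A * Real.exp (-(m * s))) t = A / m * (1 - Real.exp (-(m * t))) := by
  have hd : ∀ x ∈ uIcc 0 t, HasDerivAt (fun s => -(A / m) * Real.exp (-(m * s)))
      (A * Real.exp (-(m * x))) x := fun x _ => by
    have h1 : HasDerivAt (fun s : ℝ => -(m * s)) (-(m * 1)) x :=
      ((hasDerivAt_id x).const_mul m).neg
    refine (h1.exp.const_mul (-(A / m))).congr_deriv ?_
    field_simp
  rw [𝔍, intervalIntegral.integral_eq_sub_of_hasDerivAt hd
    (by apply Continuous.intervalIntegrable; fun_prop)]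
  simp
  ring

end Integral

/-- Lemma 2: for a tree of diameter at most 3, given a solution of
(66)–(69) on `[0,T]` and bounded measurable `f_i ≥ 0`, one can modify it into a solution
`(ψ̂, ŷ, ẑ, ŵ)` of (66)–(69) on `[0,T]` with `∑ ŷ ≥ ∑ y`, `∑ ẑ ≤ ∑ z` and
`ŵ_i = w_i + f_i + η_i`, where `η_i` is nondecreasing, continuous and
`0 ≤ η_i ≤ m₅ T ∑_{i'} |f_{i'}|*_T`. -/
theorem perturbation_lemma
    {I J : Type*} [Fintype I] [Fintype J] [Nonempty I] [Nonempty J]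
    (i₀ : I) (j₀ : J) (μ : I × J → ℝ) (θ : I → ℝ)
    (hμpos : ∀ i j, (j = j₀ ∨ i = i₀) → 0 < μ (i, j))
    (hμzero : ∀ i j, ¬(j = j₀ ∨ i = i₀) → μ (i, j) = 0)
    (hθ : ∀ i, 0 ≤ θ i) :
    ∃ m₅ : ℝ, 0 < m₅ ∧
      ∀ T : ℝ, 0 < T →
      ∀ (ψ : I → J → ℝ → ℝ) (y w : I → ℝ → ℝ) (z : J → ℝ → ℝ),
        (∀ i j, Measurable (ψ i j) ∧ ∃ C : ℝ, ∀ t ∈ Icc (0:ℝ) T, |ψ i j t| ≤ C) →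
        (∀ i, Measurable (y i) ∧ ∃ C : ℝ, ∀ t ∈ Icc (0:ℝ) T, |y i t| ≤ C) →
        (∀ i, Measurable (w i) ∧ ∃ C : ℝ, ∀ t ∈ Icc (0:ℝ) T, |w i t| ≤ C) →
        (∀ j, Measurable (z j) ∧ ∃ C : ℝ, ∀ t ∈ Icc (0:ℝ) T, |z j t| ≤ C) →
        Sys i₀ j₀ μ θ ψ y w z (Icc (0:ℝ) T) →
      ∀ f : I → ℝ → ℝ,
        (∀ i, Measurable (f i)) →
        (∀ i, ∃ C : ℝ, ∀ t ∈ Icc (0:ℝ) T, |f i t| ≤ C) →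
        (∀ i, ∀ t ∈ Icc (0:ℝ) T, 0 ≤ f i t) →
        ∃ (ψ' : I → J → ℝ → ℝ) (y' w' : I → ℝ → ℝ) (z' : J → ℝ → ℝ) (η : I → ℝ → ℝ),
          (∀ i j, Measurable (ψ' i j) ∧ ∃ C : ℝ, ∀ t ∈ Icc (0:ℝ) T, |ψ' i j t| ≤ C) ∧
          (∀ i, Measurable (y' i) ∧ ∃ C : ℝ, ∀ t ∈ Icc (0:ℝ) T, |y' i t| ≤ C) ∧
          (∀ i, Measurable (w' i) ∧ ∃ C : ℝ, ∀ t ∈ Icc (0:ℝ) T, |w' i t| ≤ C) ∧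
          (∀ j, Measurable (z' j) ∧ ∃ C : ℝ, ∀ t ∈ Icc (0:ℝ) T, |z' j t| ≤ C) ∧
          Sys i₀ j₀ μ θ ψ' y' w' z' (Icc (0:ℝ) T) ∧
          (∀ t ∈ Icc (0:ℝ) T, ∑ i, y i t ≤ ∑ i, y' i t) ∧
          (∀ t ∈ Icc (0:ℝ) T, ∑ j, z' j t ≤ ∑ j, z j t) ∧
          (∀ i, ∀ t ∈ Icc (0:ℝ) T, w' i t = w i t + f i t + η i t) ∧
          (∀ i, MonotoneOn (η i) (Icc (0:ℝ) T)) ∧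
          (∀ i, ContinuousOn (η i) (Icc (0:ℝ) T)) ∧
          (∀ i, ∀ t ∈ Icc (0:ℝ) T,
            0 ≤ η i t ∧
            η i t ≤ m₅ * T * ∑ i', sSup ((fun s => |f i' s|) '' Icc (0:ℝ) T)) := by
  classical
  obtain ⟨j₁, hj₁⟩ := Finite.exists_min fun j => μ (i₀, j)
  set m := μ (i₀, j₁)
  set A := μ (i₀, j₀)
  have hm : 0 < m := hμpos _ _ (Or.inr rfl)
  have hA : 0 < A := hμpos _ _ (Or.inr rfl)
  have hμ0 : ∀ i j, 0 ≤ μ (i, j) := fun i j => by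
    by_cases hij : j = j₀ ∨ i = i₀
    · exact (hμpos i j hij).le
    · exact (hμzero i j hij).ge
  have hrate : ∀ i, 0 ≤ θ i + ∑ j, μ (i, j) := fun i =>
    add_nonneg (hθ i) (Finset.sum_nonneg fun j _ => hμ0 i j)
  refine ⟨(∑ i, (θ i + ∑ j, μ (i, j))) * (1 + A / m) + A,
    add_pos_of_nonneg_of_pos (mul_nonneg (Finset.sum_nonneg fun i _ => hrate i) (by positivity)) hA,
    ?_⟩
  intro T hT ψ y w z hψ hy hw hz hsys f hf hfb hf0
  obtain ⟨hE, h66, h67, hy0, hz0, hmin⟩ := hsys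
  set F := ∑ i', sSup ((fun s => |f i' s|) '' Icc (0:ℝ) T)
  have hfF : ∀ t ∈ Icc (0:ℝ) T, ∑ i, f i t ≤ F := fun t ht =>
    Finset.sum_le_sum fun i _ => by
      obtain ⟨C, hC⟩ := hfb i
      refine (le_abs_self _).trans (le_csSup ⟨C, ?_⟩ ⟨t, ht, rfl⟩)
      rintro _ ⟨s, hs, rfl⟩
      exact hC s hs
  have h00 : (0:ℝ) ∈ Icc 0 T := ⟨le_rfl, hT.le⟩
  have hF : 0 ≤ F := (Finset.sum_nonneg fun i _ => hf0 i 0 h00).trans (hfF 0 h00)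
  -- the extra input at `i₀`, and its integral
  set k : ℝ → ℝ := fun s => A * F * Real.exp (-(m * s)) with hk_def
  set h : ℝ → ℝ := fun s => A * F / m * (1 - Real.exp (-(m * s))) with hh_def
  have hkh : ∀ t, 𝔍 k t = h t := fun t => 𝔍_exp hm (A * F) t
  have hk : Measurable k := by fun_prop
  have hh : Measurable h := by fun_prop
  have hk0 : ∀ t, 0 ≤ k t := fun t => by positivity
  have hkA : ∀ t ∈ Icc (0:ℝ) T, k t ≤ A * F := fun t ht =>
    mul_le_of_le_one_right (by positivity)
      (Real.exp_le_one_iff.2 (neg_nonpos.2 (mul_nonneg hm.le ht.1)))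
  have hkm : ∀ t, k t + m * h t = A * F := fun t => by
    simp only [hk_def, hh_def]; field_simp; ring
  have hh0 : ∀ t ∈ Icc (0:ℝ) T, 0 ≤ h t := fun t ht => by
    rw [← hkh]; exact 𝔍_nonneg (fun s _ => hk0 s) ht
  have hhA : ∀ t, h t ≤ A / m * F := fun t =>
    (mul_le_of_le_one_right (by positivity) (by linarith [Real.exp_pos (-(m * t))])).trans_eq
      (by ring)
  set D : ℝ := (1 + A / m) * F with hD_def
  have hD0 : 0 ≤ D := by positivity
  have hDt : ∀ t ∈ Icc (0:ℝ) T, ∑ i, f i t + h t ≤ D := fun t ht => by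
    linarith [hfF t ht, hhA t]
  -- the increments
  set dy : I → ℝ → ℝ := fun i t => incrY i₀ (fun i => f i t) (fun j => z j t) (h t) i
  set dz : J → ℝ → ℝ := fun j t => incrZ (fun i => f i t) (fun j => z j t) (h t) j
  set dψ : I → J → ℝ → ℝ :=
    fun i j t => incrPsi i₀ j₀ (fun i => f i t) (fun j => z j t) (h t) i j with hdψ_def
  have mdy : ∀ i, Measurable (dy i) := measurable_incrY hf (fun j => (hz j).1) hh
  have mdz : ∀ j, Measurable (dz j) := measurable_incrZ hf (fun j => (hz j).1) hh
  have mdψ : ∀ i j, Measurable (dψ i j) := measurable_incrPsi hf (fun j => (hz j).1) hh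
  have hf0' : ∀ t ∈ Icc (0:ℝ) T, ∀ i, 0 ≤ f i t := fun t ht i => hf0 i t ht
  have hz0' : ∀ t ∈ Icc (0:ℝ) T, ∀ j, 0 ≤ z j t := fun t ht j => hz0 j t ht
  have dy0 : ∀ i, ∀ t ∈ Icc (0:ℝ) T, 0 ≤ dy i t := fun i t ht => incrY_nonneg (hf0' t ht) i
  have dyD : ∀ i, ∀ t ∈ Icc (0:ℝ) T, dy i t ≤ D := fun i t ht =>
    (incrY_le (hf0' t ht) (hz0' t ht) (hh0 t ht) i).trans (hDt t ht)
  have dyD' : ∀ i, ∀ t ∈ Icc (0:ℝ) T, |dy i t| ≤ D := fun i t ht => by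
    rw [abs_of_nonneg (dy0 i t ht)]; exact dyD i t ht
  have dz0 : ∀ j, ∀ t ∈ Icc (0:ℝ) T, dz j t ≤ 0 := fun j t ht =>
    incrZ_nonpos (hf0' t ht) (hz0' t ht) (hh0 t ht) j
  have dzz : ∀ j, ∀ t ∈ Icc (0:ℝ) T, -z j t ≤ dz j t := fun j t ht =>
    neg_le_incrZ (hf0' t ht) (hz0' t ht) (hh0 t ht) j
  have dψD : ∀ i j, ∀ t ∈ Icc (0:ℝ) T, |dψ i j t| ≤ D := fun i j t ht =>
    (abs_incrPsi_le (hf0' t ht) (hz0' t ht) (hh0 t ht) i j).trans (hDt t ht)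
  -- the rate of `η`
  set v : I → ℝ → ℝ := fun i t =>
    θ i * dy i t + ∑ j, μ (i, j) * dψ i j t + if i = i₀ then k t else 0 with hv_def
  have hite : ∀ i, Measurable fun t => if i = i₀ then k t else 0 := fun i => by
    split_ifs
    · exact hk
    · exact measurable_const
  have mv : ∀ i, Measurable (v i) := fun i => by
    have := hite i
    fun_prop
  have v0 : ∀ i, ∀ t ∈ Icc (0:ℝ) T, 0 ≤ v i t := by
    intro i t ht
    have h1 := mul_nonneg (hθ i) (dy0 i t ht)
    by_cases hi : i = i₀
    · subst hi
      have h2 := weighted_sum_incrPsi_ge (i₀ := i) (j₀ := j₀) (hf0' t ht) (hz0' t ht) (hh0 t ht)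
        hm.le hj₁
      have h3 : A * ∑ i, f i t ≤ A * F := mul_le_mul_of_nonneg_left (hfF t ht) hA.le
      have h4 : -k t ≤ min 0 (m * h t - μ (i, j₀) * ∑ i, f i t) :=
        le_min (neg_nonpos.2 (hk0 t)) (by linarith [hkm t])
      simp only [hv_def, if_true]
      linarith
    · simp only [hv_def, hi, if_false, add_zero]
      exact add_nonneg h1 (Finset.sum_nonneg fun j _ =>
        mul_nonneg (hμ0 i j) (incrPsi_nonneg (hf0' t ht) hi j))
  set M := (∑ i, (θ i + ∑ j, μ (i, j))) * (1 + A / m) + A with hM_def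
  have vM : ∀ i, ∀ t ∈ Icc (0:ℝ) T, v i t ≤ M * F := by
    intro i t ht
    have h1 : θ i * dy i t ≤ θ i * D := mul_le_mul_of_nonneg_left (dyD i t ht) (hθ i)
    have h2 : ∑ j, μ (i, j) * dψ i j t ≤ (∑ j, μ (i, j)) * D := by
      rw [Finset.sum_mul]
      exact Finset.sum_le_sum fun j _ =>
        mul_le_mul_of_nonneg_left ((le_abs_self _).trans (dψD i j t ht)) (hμ0 i j)
    have h3 : (if i = i₀ then k t else 0) ≤ A * F := by
      split_ifs
      · exact hkA t ht
      · positivity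
    have h4 : (θ i + ∑ j, μ (i, j)) * D ≤ (∑ i, (θ i + ∑ j, μ (i, j))) * D :=
      mul_le_mul_of_nonneg_right
        (Finset.single_le_sum (fun i _ => hrate i) (Finset.mem_univ i)) hD0
    calc v i t ≤ (∑ i, (θ i + ∑ j, μ (i, j))) * D + A * F := by
          simp only [hv_def]; linarith
      _ = M * F := by simp only [hM_def, hD_def]; ring
  have vM' : ∀ i, ∀ t ∈ Icc (0:ℝ) T, |v i t| ≤ M * F := fun i t ht => by
    rw [abs_of_nonneg (v0 i t ht)]; exact vM i t ht
  have η_mono : ∀ i, MonotoneOn (𝔍 (v i)) (Icc 0 T) := fun i => 𝔍_monotoneOn (mv i) (v0 i) (vM i)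
  have η_cont : ∀ i, ContinuousOn (𝔍 (v i)) (Icc 0 T) := fun i =>
    𝔍_continuousOn hT.le (mv i) (vM' i)
  have η_eq : ∀ i, ∀ t ∈ Icc (0:ℝ) T, 𝔍 (v i) t =
      θ i * 𝔍 (dy i) t + ∑ j, μ (i, j) * 𝔍 (dψ i j) t + if i = i₀ then h t else 0 := by
    intro i t ht
    have i1 : IntervalIntegrable (fun s => θ i * dy i s) volume 0 t :=
      (intervalIntegrable_of_bounded (mdy i) (dyD' i) h00 ht).const_mul _
    have i2 : ∀ j ∈ Finset.univ, IntervalIntegrable (fun s => μ (i, j) * dψ i j s) volume 0 t :=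
      fun j _ => (intervalIntegrable_of_bounded (mdψ i j) (dψD i j) h00 ht).const_mul _
    have i2' : IntervalIntegrable (fun s => ∑ j, μ (i, j) * dψ i j s) volume 0 t := by
      simpa only [Finset.sum_fn] using IntervalIntegrable.sum _ i2
    have i3 : IntervalIntegrable (fun s => if i = i₀ then k s else 0) volume 0 t :=
      intervalIntegrable_of_bounded (C := A * F) (hite i) (fun s hs => by
        split_ifs
        · rw [abs_of_nonneg (hk0 s)]; exact hkA s hs
        · rw [abs_zero]; positivity) h00 ht
    have e3 : ∫ s in (0:ℝ)..t, (if i = i₀ then k s else 0) = if i = i₀ then h t else 0 := by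
      split_ifs
      · exact hkh t
      · simp
    calc 𝔍 (v i) t = ∫ s in (0:ℝ)..t,
          (θ i * dy i s + ∑ j, μ (i, j) * dψ i j s + if i = i₀ then k s else 0) := rfl
      _ = _ := by
        rw [intervalIntegral.integral_add (i1.add i2') i3, intervalIntegral.integral_add i1 i2',
          intervalIntegral.integral_finsetSum i2, e3]
        simp only [intervalIntegral.integral_const_mul, 𝔍]
  have 𝔍_ψ : ∀ i j, ∀ t ∈ Icc (0:ℝ) T,
      𝔍 (fun s => ψ i j s + dψ i j s) t = 𝔍 (ψ i j) t + 𝔍 (dψ i j) t := fun i j t ht => by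
    obtain ⟨hm', C, hC⟩ := hψ i j
    exact intervalIntegral.integral_add (intervalIntegrable_of_bounded hm' hC h00 ht)
      (intervalIntegrable_of_bounded (mdψ i j) (dψD i j) h00 ht)
  have 𝔍_y : ∀ i, ∀ t ∈ Icc (0:ℝ) T,
      𝔍 (fun s => y i s + dy i s) t = 𝔍 (y i) t + 𝔍 (dy i) t := fun i t ht => by
    obtain ⟨hm', C, hC⟩ := hy i
    exact intervalIntegral.integral_add (intervalIntegrable_of_bounded hm' hC h00 ht)
      (intervalIntegrable_of_bounded (mdy i) (dyD' i) h00 ht)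
  have hw' : ∀ i, ∀ t ∈ Icc (0:ℝ) T,
      ∑ j, ((ψ i j t + dψ i j t) + μ (i, j) * 𝔍 (fun s => ψ i j s + dψ i j s) t) =
      (w i t + f i t + 𝔍 (v i) t) - (y i t + dy i t) - θ i * 𝔍 (fun s => y i s + dy i s) t := by
    intro i t ht
    have e1 := h66 i t ht
    have e2 : ∑ j, dψ i j t + dy i t = f i t + if i = i₀ then h t else 0 :=
      sum_incrPsi_add_incrY (hf0' t ht) (hz0' t ht) (hh0 t ht) i
    rw [𝔍_y i t ht, η_eq i t ht]
    have e3 : ∑ j, ((ψ i j t + dψ i j t) + μ (i, j) * 𝔍 (fun s => ψ i j s + dψ i j s) t) =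
        ∑ j, (ψ i j t + μ (i, j) * 𝔍 (ψ i j) t) +
          (∑ j, dψ i j t + ∑ j, μ (i, j) * 𝔍 (dψ i j) t) := by
      rw [← Finset.sum_add_distrib, ← Finset.sum_add_distrib]
      refine Finset.sum_congr rfl fun j _ => ?_
      rw [𝔍_ψ i j t ht]; ring
    rw [e3, e1]
    linarith
  -- `w` is only constrained on the interval, where the measurable extension below agrees with it
  refine ⟨fun i j t => ψ i j t + dψ i j t, fun i t => y i t + dy i t,
    fun i t => w i t + f i t + 𝔍 (v i) (projIcc 0 T hT.le t), fun j t => z j t + dz j t,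
    fun i => 𝔍 (v i), ?_, ?_, ?_, ?_, ⟨?_, ?_, ?_, ?_, ?_, ?_⟩, ?_, ?_, ?_, η_mono, η_cont, ?_⟩
  · intro i j
    obtain ⟨hm', C, hC⟩ := hψ i j
    exact ⟨hm'.add (mdψ i j), C + D, fun t ht =>
      (abs_add_le _ _).trans (add_le_add (hC t ht) (dψD i j t ht))⟩
  · intro i
    obtain ⟨hm', C, hC⟩ := hy i
    exact ⟨hm'.add (mdy i), C + D, fun t ht =>
      (abs_add_le _ _).trans (add_le_add (hC t ht) (dyD' i t ht))⟩
  · intro i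
    obtain ⟨hm', C, hC⟩ := hw i
    obtain ⟨C', hC'⟩ := hfb i
    have hc : Continuous fun t => 𝔍 (v i) (projIcc 0 T hT.le t) :=
      (continuousOn_iff_continuous_domRestrict.1 (η_cont i)).comp continuous_projIcc
    refine ⟨(hm'.add (hf i)).add hc.measurable, C + C' + M * F * T, fun t ht => ?_⟩
    refine (abs_add_le _ _).trans (add_le_add ((abs_add_le _ _).trans
      (add_le_add (hC t ht) (hC' t ht))) ?_)
    have hp := (projIcc 0 T hT.le t).2
    rw [abs_of_nonneg (𝔍_nonneg (v0 i) hp)]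
    exact 𝔍_le (mv i) (v0 i) (vM i) hp
  · intro j
    obtain ⟨hm', C, hC⟩ := hz j
    refine ⟨hm'.add (mdz j), C, fun t ht => ?_⟩
    have := hC t ht
    rw [abs_of_nonneg (hz0 j t ht)] at this
    rw [abs_of_nonneg (by linarith [dzz j t ht])]
    linarith [dz0 j t ht]
  · intro i j hij t ht
    simp only [hE i j hij t ht, hdψ_def, incrPsi_eq_zero hij, add_zero]
  · intro i t ht
    simp only [projIcc_of_mem hT.le ht]
    exact hw' i t ht
  · intro j t ht
    have : ∑ i, dψ i j t = -dz j t := sum_incrPsi (hf0' t ht) j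
    simp only [Finset.sum_add_distrib, h67 j t ht, this]
    ring
  · exact fun i t ht => add_nonneg (hy0 i t ht) (dy0 i t ht)
  · exact fun j t ht => by linarith [dzz j t ht]
  · intro t ht
    have hys : 0 ≤ ∑ i, (y i t + dy i t) :=
      Finset.sum_nonneg fun i _ => add_nonneg (hy0 i t ht) (dy0 i t ht)
    have hzs : 0 ≤ ∑ j, (z j t + dz j t) :=
      Finset.sum_nonneg fun j _ => by linarith [dzz j t ht]
    have ey : ∑ i, dy i t = ∑ i, f i t + h t - min (∑ j, z j t) (∑ i, f i t + h t) :=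
      sum_incrY (hf0' t ht)
    have ez : ∑ j, dz j t = -min (∑ j, z j t) (∑ i, f i t + h t) :=
      sum_incrZ (hf0' t ht) (hz0' t ht) (hh0 t ht)
    have hg : 0 ≤ ∑ i, f i t + h t := sum_nonneg_add (hf0' t ht) (hh0 t ht)
    have hzn : 0 ≤ ∑ j, z j t := Finset.sum_nonneg fun j _ => hz0 j t ht
    have h0 := hmin t ht
    simp only [Finset.sum_add_distrib, ey, ez] at hys hzs ⊢
    rcases le_total (∑ j, z j t) (∑ i, f i t + h t) with hle | hle
    · rw [min_eq_left hle] at hys ⊢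
      rw [add_neg_cancel]
      exact min_eq_right hys
    · rw [min_eq_right hle] at hzs ⊢
      rw [sub_self, add_zero]
      rcases min_eq_iff.1 h0 with ⟨h1, -⟩ | ⟨h1, -⟩
      · rw [h1]; exact min_eq_left hzs
      · rw [show ∑ j, z j t + -(∑ i, f i t + h t) = 0 by linarith]
        exact min_eq_right (Finset.sum_nonneg fun i _ => hy0 i t ht)
  · exact fun t ht => Finset.sum_le_sum fun i _ => by linarith [dy0 i t ht]
  · exact fun t ht => Finset.sum_le_sum fun j _ => by linarith [dz0 j t ht]
  · intro i t ht
    simp only [projIcc_of_mem hT.le ht]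
  · intro i t ht
    refine ⟨𝔍_nonneg (v0 i) ht, (𝔍_le (mv i) (v0 i) (vM i) ht).trans_eq ?_⟩
    ring
end

section
/- Let I and J be nonempty finite sets and let E ⊆ I × J be such that the bipartite graph on the disjoint union I ⊔ J, having an edge between i ∈ I and j ∈ J if and only if (i,j) ∈ E, is a tree (connected and acyclic). Then for any real numbers α_i (i ∈ I) and β_j (j ∈ J) with ∑_{i∈I} α_i = ∑_{j∈J} β_j, there exists a unique function ψ : I × J → ℝ such that ψ_ij = 0 for all (i,j) ∉ E, ∑_{j∈J} ψ_ij = α_i for every i ∈ I, and ∑_{i∈I} ψ_ij = β_j for every j ∈ J. -/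
open Set

theorem edgeSet_actGraph {I J : Type*} (E : Set (I × J)) :
    (actGraph E).edgeSet = (fun p : I × J => s(Sum.inl p.1, Sum.inr p.2)) '' E := by
  ext e
  induction e with
  | _ a b =>
    rw [SimpleGraph.mem_edgeSet]
    rcases a with a | a <;> rcases b with b | b <;> simp [actGraph]

theorem card_add_one_of_isTree {I J : Type*} [Finite I] [Finite J] {E : Set (I × J)}
    (htree : (actGraph E).IsTree) : Nat.card E + 1 = Nat.card (I ⊕ J) := by
  have h := (SimpleGraph.isTree_iff_connected_and_card.1 htree).2
  rw [edgeSet_actGraph, Nat.card_image_of_injective] at h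
  · exact h
  · rintro ⟨i, j⟩ ⟨i', j'⟩ h
    simpa using h

/-- On a connected activity graph, a potential whose endpoint sums vanish on every edge is
determined by its value at one vertex of `I`. -/
theorem eq_zero_of_add_eq_zero {I J : Type*} {E : Set (I × J)}
    (hconn : (actGraph E).Connected) {f : I ⊕ J → ℝ}
    (hf : ∀ p ∈ E, f (Sum.inl p.1) + f (Sum.inr p.2) = 0) {i₀ : I}
    (h₀ : f (Sum.inl i₀) = 0) : f = 0 := by
  let g : I ⊕ J → ℝ := Sum.elim (fun i => f (Sum.inl i)) (fun j => -f (Sum.inr j))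
  have hadj : ∀ a b, (actGraph E).Adj a b → g a = g b := by
    rintro (a | a) (b | b) h <;> simp [actGraph] at h
    · have := hf _ h
      simp only [g, Sum.elim_inl, Sum.elim_inr]
      linarith
    · have := hf _ h
      simp only [g, Sum.elim_inl, Sum.elim_inr]
      linarith
  have hwalk : ∀ a b, (actGraph E).Walk a b → g a = g b := by
    intro a b w
    induction w with
    | nil => rfl
    | cons h _ ih => exact (hadj _ _ h).trans ih
  funext v
  obtain ⟨w⟩ := hconn.preconnected (Sum.inl i₀) v
  have := hwalk _ _ w
  rcases v with v | v <;> simp only [g, Sum.elim_inl, Sum.elim_inr] at this <;>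
    simp only [Pi.zero_apply] <;> linarith

/-- On a tree, every function on the activities is the sum of a potential at its endpoints. -/
theorem exists_potential {I J : Type*} [Fintype I] [Fintype J] [Nonempty I]
    {E : Set (I × J)} (htree : (actGraph E).IsTree) (ψ : I × J → ℝ) :
    ∃ f : I ⊕ J → ℝ, ∀ p ∈ E, f (Sum.inl p.1) + f (Sum.inr p.2) = ψ p := by
  classical
  obtain ⟨i₀⟩ := ‹Nonempty I›
  let M : (I ⊕ J → ℝ) →ₗ[ℝ] (E → ℝ) × ℝ :=
    { toFun := fun f => (fun e => f (Sum.inl e.1.1) + f (Sum.inr e.1.2), f (Sum.inl i₀))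
      map_add' := by
        intro f g
        ext <;> simp
        ring
      map_smul' := by
        intro c f
        ext <;> simp
        ring }
  have hinj : Function.Injective M := by
    rw [injective_iff_map_eq_zero]
    intro f hf
    have h := Prod.mk.inj hf
    exact eq_zero_of_add_eq_zero htree.connected (fun p hp => congrFun h.1 ⟨p, hp⟩) h.2
  have hdim : Module.finrank ℝ (I ⊕ J → ℝ) = Module.finrank ℝ ((E → ℝ) × ℝ) := by
    have := card_add_one_of_isTree htree
    simp only [Nat.card_eq_fintype_card] at this
    rw [Module.finrank_prod, Module.finrank_self, Module.finrank_fintype_fun_eq_card,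
      Module.finrank_fintype_fun_eq_card, this]
  obtain ⟨f, hf⟩ := (LinearMap.injective_iff_surjective_of_finrank_eq_finrank hdim).1 hinj
    (fun e => ψ e, 0)
  exact ⟨f, fun p hp => congrFun (Prod.mk.inj hf).1 ⟨p, hp⟩⟩

/-- On a tree, a function supported on the activities with vanishing margins is zero. -/
theorem eq_zero_of_margins_eq_zero {I J : Type*} [Fintype I] [Fintype J] [Nonempty I]
    {E : Set (I × J)} (htree : (actGraph E).IsTree) {ψ : I × J → ℝ}
    (hE : ∀ p, p ∉ E → ψ p = 0) (hrow : ∀ i, ∑ j, ψ (i, j) = 0)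
    (hcol : ∀ j, ∑ i, ψ (i, j) = 0) : ψ = 0 := by
  obtain ⟨f, hf⟩ := exists_potential htree ψ
  have hsq : ∑ p, ψ p * ψ p = 0 := by
    calc ∑ p, ψ p * ψ p
        = ∑ p : I × J, (f (Sum.inl p.1) * ψ p + f (Sum.inr p.2) * ψ p) := by
          refine Finset.sum_congr rfl fun p _ => ?_
          by_cases hp : p ∈ E
          · rw [← add_mul, hf p hp]
          · simp [hE p hp]
      _ = 0 := by
          rw [Finset.sum_add_distrib, Fintype.sum_prod_type, Fintype.sum_prod_type_right]
          simp [← Finset.mul_sum, hrow, hcol]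
  funext p
  have := (Finset.sum_eq_zero_iff_of_nonneg fun p _ => mul_self_nonneg (ψ p)).1 hsq p
    (Finset.mem_univ p)
  simpa using this

/-- On a tree, balanced margins are attained by a function supported on the activities. -/
theorem exists_margins {I J : Type*} [Fintype I] [Fintype J] [Nonempty I]
    {E : Set (I × J)} (htree : (actGraph E).IsTree)
    {α : I → ℝ} {β : J → ℝ} (hsum : ∑ i, α i = ∑ j, β j) :
    ∃ ψ : I × J → ℝ, (∀ p, p ∉ E → ψ p = 0) ∧
      (∀ i, ∑ j, ψ (i, j) = α i) ∧ (∀ j, ∑ i, ψ (i, j) = β j) := by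
  classical
  let i₀ := Classical.arbitrary I
  let X : (E → ℝ) →ₗ[ℝ] (I × J → ℝ) := Function.ExtendByZero.linearMap ℝ Subtype.val
  have hX : ∀ g, ∀ p, p ∉ E → X g p = 0 := fun g p hp =>
    Function.extend_apply' _ _ _ (by rintro ⟨e, rfl⟩; exact hp e.2)
  have hX' : ∀ g (e : E), X g e = g e := fun g e => Subtype.val_injective.extend_apply _ _ _
  let T : (E → ℝ) × ℝ →ₗ[ℝ] (I → ℝ) × (J → ℝ) :=
    { toFun := fun x => (fun i => ∑ j, X x.1 (i, j) + Pi.single (M := fun _ => ℝ) i₀ x.2 i,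
        fun j => ∑ i, X x.1 (i, j))
      map_add' := by
        intro x y
        ext <;> simp [Finset.sum_add_distrib, Pi.single_add]
        ring
      map_smul' := by
        intro c x
        ext <;> simp [Finset.mul_sum, mul_add, Pi.single_apply] }
  have hbal : ∀ x, ∑ i, (T x).1 i = ∑ j, (T x).2 j + x.2 := by
    intro x
    change ∑ i, (∑ j, X x.1 (i, j) + Pi.single (M := fun _ => ℝ) i₀ x.2 i)
      = ∑ j, ∑ i, X x.1 (i, j) + x.2
    rw [Finset.sum_add_distrib, Finset.sum_comm]
    simp
  have hinj : Function.Injective T := by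
    rw [injective_iff_map_eq_zero]
    rintro ⟨g, c⟩ hx
    have hc : c = 0 := by
      have := hbal (g, c)
      rw [hx] at this
      simpa using this.symm
    subst hc
    have h := Prod.mk.inj hx
    have hz : X g = 0 := eq_zero_of_margins_eq_zero htree (hX g)
      (fun i => by simpa using congrFun h.1 i) (fun j => congrFun h.2 j)
    refine Prod.ext (funext fun e => ?_) rfl
    change g e = 0
    rw [← hX' g e, hz]
    rfl
  have hdim : Module.finrank ℝ ((E → ℝ) × ℝ) = Module.finrank ℝ ((I → ℝ) × (J → ℝ)) := by
    have := card_add_one_of_isTree htree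
    simp only [Nat.card_eq_fintype_card, Fintype.card_sum] at this
    simp only [Module.finrank_prod, Module.finrank_self, Module.finrank_fintype_fun_eq_card, this]
  obtain ⟨⟨g, c⟩, hx⟩ :=
    (LinearMap.injective_iff_surjective_of_finrank_eq_finrank hdim).1 hinj (α, β)
  have hc : c = 0 := by
    have := hbal (g, c)
    rw [hx] at this
    simpa [hsum] using this.symm
  subst hc
  have h := Prod.mk.inj hx
  exact ⟨X g, hX g, fun i => by simpa using congrFun h.1 i, fun j => congrFun h.2 j⟩

/-- Proposition A.2: if the buffer–station graph is a tree, then for any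
`α_i`, `β_j` with `∑ α_i = ∑ β_j` there exists a unique `ψ : I × J → ℝ`, vanishing off `E`,
with row sums `α` and column sums `β`. -/
theorem unique_psi_of_tree
    {I J : Type*} [Fintype I] [Fintype J] [Nonempty I] [Nonempty J]
    (E : Set (I × J)) (htree : (actGraph E).IsTree)
    (α : I → ℝ) (β : J → ℝ) (hsum : ∑ i, α i = ∑ j, β j) :
    ∃! ψ : I × J → ℝ,
      (∀ p : I × J, p ∉ E → ψ p = 0) ∧
      (∀ i, ∑ j, ψ (i, j) = α i) ∧
      (∀ j, ∑ i, ψ (i, j) = β j) := by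
  obtain ⟨ψ, hE, hrow, hcol⟩ := exists_margins htree hsum
  refine ⟨ψ, ⟨hE, hrow, hcol⟩, ?_⟩
  rintro φ ⟨hE', hrow', hcol'⟩
  refine sub_eq_zero.1 (eq_zero_of_margins_eq_zero htree ?_ ?_ ?_)
  · intro p hp
    simp [hE p hp, hE' p hp]
  · intro i
    simp [hrow, hrow']
  · intro j
    simp [hcol, hcol']
end

section
/- Consider the system with two classes I = {1,2}, two stations J = {A,B}, all four pairs being activities, service rates μ_{1A} = μ_{2A} = 1, μ_{1B} = μ_{2B} = 2, and arbitrary abandonment rates θ₁, θ₂ ≥ 0. For every k > 0, the functions defined by ψ_{1A}(t) = k, ψ_{2A}(t) = −k, ψ_{1B}(t) = −k(1+e^{−2t})/2, ψ_{2B}(t) = k(1+e^{−2t})/2, x₁(t) = k(1−e^{−2t})/2, x₂(t) = −x₁(t), y₁ = y₂ = 0, z_A = z_B = 0 and w₁ = w₂ = 0 satisfy the system: x_i(t) = w_i(t) − ∑_{j∈J} μ_ij (𝔍ψ_ij)(t) − θ_i (𝔍y_i)(t); ∑_{j∈J} ψ_ij(t) = x_i(t) − y_i(t); ∑_{i∈I}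 ψ_ij(t) = −z_j(t); y_i ≥ 0, z_j ≥ 0; and min(∑_i y_i(t), ∑_j z_j(t)) = 0 for all t ≥ 0. Consequently, there is no constant m₀ > 0 such that ∑_{i∈I} |x_i(t)| ≤ m₀ (1+t)^{m₀} (1 + sup_{0≤s≤t} ∑_{i∈I} |w_i(s)|) holds for all t ≥ 0 and all continuous solutions of this system. -/
open MeasureTheory Set

/-- Service rates of Example 1: two classes, two stations `0 = A`, `1 = B`, all four pairs
are activities, `μ_{iA} = 1`, `μ_{iB} = 2`. -/
def μex : Fin 2 → Fin 2 → ℝ := fun _ j => if j = 0 then 1 else 2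

/-- The system (33)–(37) of Example 1 (with the complete bipartite activity graph on
`2 + 2` nodes and rates `μex`), holding for all `t ≥ 0`. -/
def SysEx (θ : Fin 2 → ℝ) (x y w : Fin 2 → ℝ → ℝ) (z : Fin 2 → ℝ → ℝ)
    (ψ : Fin 2 → Fin 2 → ℝ → ℝ) : Prop :=
  (∀ i, ∀ t : ℝ, 0 ≤ t →
    x i t = w i t - ∑ j, μex i j * 𝔍 (ψ i j) t - θ i * 𝔍 (y i) t) ∧
  (∀ i, ∀ t : ℝ, 0 ≤ t → ∑ j, ψ i j t = x i t - y i t) ∧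
  (∀ j, ∀ t : ℝ, 0 ≤ t → ∑ i, ψ i j t = - z j t) ∧
  (∀ i, ∀ t : ℝ, 0 ≤ t → 0 ≤ y i t) ∧
  (∀ j, ∀ t : ℝ, 0 ≤ t → 0 ≤ z j t) ∧
  (∀ t : ℝ, 0 ≤ t → min (∑ i, y i t) (∑ j, z j t) = 0)

/-- The explicit `ψ` of Example 1. -/
noncomputable def ψex (k : ℝ) : Fin 2 → Fin 2 → ℝ → ℝ := fun i j t =>
  if j = 0 then (if i = 0 then k else -k)
  else (if i = 0 then -(k * (1 + Real.exp (-2 * t)) / 2)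
        else k * (1 + Real.exp (-2 * t)) / 2)

/-- The explicit `x` of Example 1. -/
noncomputable def xex (k : ℝ) : Fin 2 → ℝ → ℝ := fun i t =>
  if i = 0 then k * (1 - Real.exp (-2 * t)) / 2
  else -(k * (1 - Real.exp (-2 * t)) / 2)

/-- The running integral of `k * (1 + exp (-2 s)) / 2`. -/
theorem integral_half_mul_one_add_exp (k t : ℝ) :
    ∫ s in (0:ℝ)..t, k * (1 + Real.exp (-2 * s)) / 2 =
      k * t / 2 + k * (1 - Real.exp (-2 * t)) / 4 := by
  have hderiv (s : ℝ) : HasDerivAt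
      (fun s : ℝ => k * s / 2 + k * (1 - Real.exp (-2 * s)) / 4)
      (k * (1 + Real.exp (-2 * s)) / 2) s := by
    have hexp : HasDerivAt (fun s : ℝ => Real.exp (-2 * s))
        (Real.exp (-2 * s) * (-2 * 1)) s := ((hasDerivAt_id' s).const_mul (-2)).exp
    refine ((((hasDerivAt_id' s).const_mul k).div_const 2).add
      (((hexp.const_sub 1).const_mul k).div_const 4)).congr_deriv ?_
    ring
  rw [intervalIntegral.integral_eq_sub_of_hasDerivAt (fun s _ => hderiv s)
    (Continuous.intervalIntegrable (by fun_prop) _ _)]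
  simp

/-- The explicit functions `xex`, `ψex` solve the system with zero input. -/
theorem sysEx_explicit (θ : Fin 2 → ℝ) (k : ℝ) :
    SysEx θ (xex k) (fun _ _ => 0) (fun _ _ => 0) (fun _ _ => 0) (ψex k) := by
  refine ⟨fun i t _ => ?_, fun i t _ => ?_, fun j t _ => ?_, fun _ _ _ => le_rfl,
    fun _ _ _ => le_rfl, fun t _ => by simp⟩
  · have hintegral := integral_half_mul_one_add_exp k t
    fin_cases i
    · simp only [Fin.zero_eta, Fin.isValue, xex, ψex, μex, 𝔍, Fin.sum_univ_two, if_true,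
        one_ne_zero, if_false, intervalIntegral.integral_neg, hintegral,
        intervalIntegral.integral_const, smul_eq_mul]
      ring
    · simp only [Fin.mk_one, Fin.isValue, xex, ψex, μex, 𝔍, Fin.sum_univ_two, if_true,
        one_ne_zero, if_false, hintegral, intervalIntegral.integral_const, smul_eq_mul]
      ring
  · fin_cases i <;> simp [xex, ψex] <;> ring
  · fin_cases j <;> simp [ψex]

theorem continuous_xex (k : ℝ) (i : Fin 2) : Continuous (xex k i) := by
  unfold xex
  split_ifs <;> fun_prop

theorem continuous_ψex (k : ℝ) (i j : Fin 2) : Continuous (ψex k i j) := by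
  unfold ψex
  split_ifs <;> fun_prop

theorem sum_abs_xex {k t : ℝ} (hk : 0 ≤ k) (ht : 0 ≤ t) :
    ∑ i, |xex k i t| = k * (1 - Real.exp (-2 * t)) := by
  have hexp : Real.exp (-2 * t) ≤ 1 := Real.exp_le_one_iff.mpr (by linarith)
  have hnonneg : 0 ≤ k * (1 - Real.exp (-2 * t)) / 2 := by
    have := mul_nonneg hk (sub_nonneg.mpr hexp)
    linarith
  simp only [xex, Fin.sum_univ_two, Fin.isValue, if_true, one_ne_zero, if_false, abs_neg,
    abs_of_nonneg hnonneg]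
  ring

/-- Example 1: without the treelike assumption, for every `k > 0` the
explicit functions of Example 1 (with `y = z = w = 0`) solve the system (33)–(37);
consequently no constant `m₀ > 0` can give the estimate
`∑_i |x_i(t)| ≤ m₀ (1+t)^{m₀} (1 + sup_{0≤s≤t} ∑_i |w_i(s)|)` for all continuous
solutions. -/
theorem example_no_tree_no_estimate
    (θ₁ θ₂ : ℝ) (hθ₁ : 0 ≤ θ₁) (hθ₂ : 0 ≤ θ₂) :
    (∀ k : ℝ, 0 < k →
      SysEx ![θ₁, θ₂] (xex k) (fun _ _ => 0) (fun _ _ => 0) (fun _ _ => 0) (ψex k)) ∧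
    ¬ ∃ m₀ : ℝ, 0 < m₀ ∧
        ∀ (x y w : Fin 2 → ℝ → ℝ) (z : Fin 2 → ℝ → ℝ)
          (ψ : Fin 2 → Fin 2 → ℝ → ℝ),
          (∀ i, Continuous (x i)) → (∀ i, Continuous (y i)) →
          (∀ i, Continuous (w i)) → (∀ j, Continuous (z j)) →
          (∀ i j, Continuous (ψ i j)) →
          SysEx ![θ₁, θ₂] x y w z ψ →
          ∀ t : ℝ, 0 ≤ t →
            ∑ i, |x i t| ≤
              m₀ * (1 + t) ^ m₀ *
                (1 + sSup ((fun s => ∑ i, |w i s|) '' Icc 0 t)) := by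
  refine ⟨fun k _ => sysEx_explicit _ k, ?_⟩
  rintro ⟨m₀, hm₀, hest⟩
  have hpos : 0 < 1 - Real.exp (-2 * 1) := sub_pos.mpr (Real.exp_lt_one_iff.mpr (by norm_num))
  set C : ℝ := m₀ * (1 + 1) ^ m₀
  have hC_pos : 0 < C := by positivity
  set k : ℝ := (C + 1) / (1 - Real.exp (-2 * 1)) with hk
  have hbound := hest (xex k) (fun _ _ => 0) (fun _ _ => 0) (fun _ _ => 0) (ψex k)
    (continuous_xex k) (fun _ => continuous_const) (fun _ => continuous_const)
    (fun _ => continuous_const) (continuous_ψex k) (sysEx_explicit _ k) 1 zero_le_one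
  have hsup : sSup ((fun _ : ℝ => ∑ _i : Fin 2, |(0 : ℝ)|) '' Icc 0 1) = 0 := by
    rw [(nonempty_Icc.mpr zero_le_one).image_const]
    simp
  rw [hsup, sum_abs_xex (by positivity) zero_le_one, hk, div_mul_cancel₀ _ hpos.ne'] at hbound
  linarith
end
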